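/- Let T be a subset of {semilattice, majority, affine} and let K be a finite collection of similar smooth finite idempotent T-restricted algebras that omit type 1. Then every finite algebra in the variety generated by K — that is, every homomorphic image of a subalgebra of a finite direct product of algebras from K — is T-restricted. -/

import Mathlib

/-! Common framework: universal algebras over a fixed signature, terms,
subalgebras, congruences, quotients, edges and their types (Bulatov's
coloured-graph approach), thin edges, connectivity, products, etc. -/

/-- A (functional) signature: a type of operation symbols with arities. -/
structure Signature where
  ops : Type
  arity : ops → ℕ

/-- An algebra of a given signature. -/
structure UAlgebra (σ : Signature) where
  carrier : Type
  interp : ∀ f : σ.ops, (Fin (σ.arity f) → carrier) → carrier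

/-- Terms over the signature `σ` in `n` variables. -/
inductive Term (σ : Signature) (n : ℕ) where
  | var : Fin n → Term σ n
  | app : (f : σ.ops) → (Fin (σ.arity f) → Term σ n) → Term σ n

/-- Evaluation of a term in an algebra; term operations of an algebra are
exactly the operations of the form `Term.eval A t`. -/
def Term.eval {σ : Signature} {n : ℕ} (A : UAlgebra σ) :
    Term σ n → (Fin n → A.carrier) → A.carrier
  | .var i, x => x i
  | .app f ts, x => A.interp f fun j => Term.eval A (ts j) x

namespace UAlgebra

variable {σ : Signature}

/-- An algebra is idempotent if all its basic operations are. -/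
def Idempotent (A : UAlgebra σ) : Prop :=
  ∀ (f : σ.ops) (a : A.carrier), A.interp f (fun _ => a) = a

/-- A set closed under all basic operations. -/
def IsClosed (A : UAlgebra σ) (S : Set A.carrier) : Prop :=
  ∀ (f : σ.ops) (x : Fin (σ.arity f) → A.carrier), (∀ j, x j ∈ S) → A.interp f x ∈ S

/-- Closure of a set under the basic operations. -/
inductive Closure (A : UAlgebra σ) (S : Set A.carrier) : A.carrier → Prop
  | base {a : A.carrier} : a ∈ S → Closure A S a
  | app (f : σ.ops) (x : Fin (σ.arity f) → A.carrier) :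
      (∀ j, Closure A S (x j)) → Closure A S (A.interp f x)

def ClosureSet (A : UAlgebra σ) (S : Set A.carrier) : Set A.carrier := {x | Closure A S x}

theorem closureSet_isClosed (A : UAlgebra σ) (S : Set A.carrier) :
    A.IsClosed (A.ClosureSet S) := fun f x h => Closure.app f x h

/-- The subalgebra of `A` on a closed subset `S`. -/
def subalg (A : UAlgebra σ) (S : Set A.carrier) (hS : A.IsClosed S) : UAlgebra σ where
  carrier := {x : A.carrier // x ∈ S}
  interp f x := ⟨A.interp f fun j => (x j : A.carrier), hS f _ fun j => (x j).2⟩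

/-- The subalgebra generated by a set `S`. -/
def Sg (A : UAlgebra σ) (S : Set A.carrier) : UAlgebra σ :=
  A.subalg (A.ClosureSet S) (A.closureSet_isClosed S)

/-- `a` as an element of `Sg {a, b}`. -/
def sgA (A : UAlgebra σ) (a b : A.carrier) : (A.Sg {a, b}).carrier :=
  ⟨a, Closure.base (Set.mem_insert a {b})⟩

/-- `b` as an element of `Sg {a, b}`. -/
def sgB (A : UAlgebra σ) (a b : A.carrier) : (A.Sg {a, b}).carrier :=
  ⟨b, Closure.base (Set.mem_insert_iff.mpr (Or.inr rfl))⟩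

/-- A congruence of an algebra. -/
structure Congruence (A : UAlgebra σ) where
  rel : A.carrier → A.carrier → Prop
  refl : ∀ x, rel x x
  symm : ∀ {x y}, rel x y → rel y x
  trans : ∀ {x y z}, rel x y → rel y z → rel x z
  compat : ∀ (f : σ.ops) (x y : Fin (σ.arity f) → A.carrier),
      (∀ j, rel (x j) (y j)) → rel (A.interp f x) (A.interp f y)

def Congruence.toSetoid {A : UAlgebra σ} (θ : Congruence A) : Setoid A.carrier :=
  ⟨θ.rel, ⟨θ.refl, θ.symm, θ.trans⟩⟩

/-- The full congruence. -/
def Congruence.IsFull {A : UAlgebra σ} (θ : Congruence A) : Prop := ∀ x y, θ.rel x y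

def Congruence.le {A : UAlgebra σ} (θ η : Congruence A) : Prop :=
  ∀ x y, θ.rel x y → η.rel x y

/-- A maximal congruence: proper, and any congruence above it is full or below it. -/
def Congruence.IsMaximal {A : UAlgebra σ} (θ : Congruence A) : Prop :=
  ¬ θ.IsFull ∧ ∀ η : Congruence A, θ.le η → ¬ η.IsFull → η.le θ

/-- The quotient (factor) algebra. -/
noncomputable def quot (A : UAlgebra σ) (θ : Congruence A) : UAlgebra σ where
  carrier := Quotient θ.toSetoid
  interp f x := Quotient.mk θ.toSetoid (A.interp f fun j => (x j).out)

/-- The class of `a` in the quotient of `Sg {a,b}` by `θ`. -/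
def qa (A : UAlgebra σ) (a b : A.carrier) (θ : Congruence (A.Sg {a, b})) :
    ((A.Sg {a, b}).quot θ).carrier :=
  Quotient.mk θ.toSetoid (A.sgA a b)

def qb (A : UAlgebra σ) (a b : A.carrier) (θ : Congruence (A.Sg {a, b})) :
    ((A.Sg {a, b}).quot θ).carrier :=
  Quotient.mk θ.toSetoid (A.sgB a b)

end UAlgebra

/-- A binary operation is a semilattice operation on a set `B`. -/
def IsSemilatticeOn {α : Type} (f : α → α → α) (B : Set α) : Prop :=
  (∀ x ∈ B, f x x = x) ∧ (∀ x ∈ B, ∀ y ∈ B, f x y = f y x) ∧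
    (∀ x ∈ B, ∀ y ∈ B, ∀ z ∈ B, f x (f y z) = f (f x y) z)

/-- A ternary operation is a majority operation on a set `B`. -/
def IsMajorityOn {α : Type} (g : α → α → α → α) (B : Set α) : Prop :=
  ∀ x ∈ B, ∀ y ∈ B, g x x y = x ∧ g x y x = x ∧ g y x x = x

/-- A ternary operation is a Mal'tsev operation on a set `B`. -/
def IsMaltsevOn {α : Type} (h : α → α → α → α) (B : Set α) : Prop :=
  ∀ x ∈ B, ∀ y ∈ B, h x y y = x ∧ h y y x = x

namespace UAlgebra

variable {σ : Signature}

/-- An algebra is "a set": every term operation is a projection. -/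
def IsSetAlgebra (Q : UAlgebra σ) : Prop :=
  ∀ (n : ℕ) (t : Term σ n), ∃ i : Fin n, ∀ x : Fin n → Q.carrier, t.eval Q x = x i

/-- An algebra is the full idempotent reduct of a module over some finite ring:
its term operations are exactly the idempotent affine combinations; in
particular the affine operation `x - y + z` is a term operation. -/
def IsAffineAlgebra (Q : UAlgebra σ) : Prop :=
  ∃ (R : Type) (_ : Ring R) (_ : Finite R) (_ : AddCommGroup Q.carrier)
    (_ : Module R Q.carrier),
    (∀ (n : ℕ) (g : (Fin n → Q.carrier) → Q.carrier),
      (∃ t : Term σ n, ∀ x, t.eval Q x = g x) ↔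
      (∃ c : Fin n → R, (∑ i, c i) = 1 ∧ ∀ x, g x = ∑ i, c i • x i)) ∧
    (∃ t : Term σ 3, ∀ x y z : Q.carrier, t.eval Q ![x, y, z] = x - y + z)

/-- `θ` witnesses that `ab` is an edge of the unary type. -/
def UnaryWitness (A : UAlgebra σ) (a b : A.carrier) (θ : Congruence (A.Sg {a, b})) : Prop :=
  θ.IsMaximal ∧ IsSetAlgebra ((A.Sg {a, b}).quot θ)

/-- `θ` witnesses that `ab` is an edge of the semilattice type. -/
def SLWitness (A : UAlgebra σ) (a b : A.carrier) (θ : Congruence (A.Sg {a, b})) : Prop :=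
  θ.IsMaximal ∧ ∃ t : Term σ 2,
    IsSemilatticeOn (fun x y => t.eval ((A.Sg {a, b}).quot θ) ![x, y])
      {A.qa a b θ, A.qb a b θ}

/-- `θ` witnesses that `ab` is an edge of the majority type. -/
def MajWitness (A : UAlgebra σ) (a b : A.carrier) (θ : Congruence (A.Sg {a, b})) : Prop :=
  θ.IsMaximal ∧
  (∃ t : Term σ 3,
    IsMajorityOn (fun x y z => t.eval ((A.Sg {a, b}).quot θ) ![x, y, z])
      {A.qa a b θ, A.qb a b θ}) ∧
  ¬ (∃ t : Term σ 2,
    IsSemilatticeOn (fun x y => t.eval ((A.Sg {a, b}).quot θ) ![x, y])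
      {A.qa a b θ, A.qb a b θ})

/-- `θ` witnesses that `ab` is an edge of the affine type. -/
def AffWitness (A : UAlgebra σ) (a b : A.carrier) (θ : Congruence (A.Sg {a, b})) : Prop :=
  θ.IsMaximal ∧ IsAffineAlgebra ((A.Sg {a, b}).quot θ)

/-- A pair of distinct elements is an edge. -/
def IsEdge (A : UAlgebra σ) (a b : A.carrier) : Prop :=
  a ≠ b ∧ ∃ θ : Congruence (A.Sg {a, b}), ¬ θ.IsFull ∧
    (IsSetAlgebra ((A.Sg {a, b}).quot θ) ∨
     IsAffineAlgebra ((A.Sg {a, b}).quot θ) ∨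
     (∃ t : Term σ 2,
        IsSemilatticeOn (fun x y => t.eval ((A.Sg {a, b}).quot θ) ![x, y])
          {A.qa a b θ, A.qb a b θ}) ∨
     (∃ t : Term σ 3,
        IsMajorityOn (fun x y z => t.eval ((A.Sg {a, b}).quot θ) ![x, y, z])
          {A.qa a b θ, A.qb a b θ}))

def IsUnaryEdge (A : UAlgebra σ) (a b : A.carrier) : Prop :=
  a ≠ b ∧ ∃ θ : Congruence (A.Sg {a, b}), UnaryWitness A a b θ

def IsSLEdge (A : UAlgebra σ) (a b : A.carrier) : Prop :=
  a ≠ b ∧ ∃ θ : Congruence (A.Sg {a, b}), SLWitness A a b θ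

def IsMajEdge (A : UAlgebra σ) (a b : A.carrier) : Prop :=
  a ≠ b ∧ ∃ θ : Congruence (A.Sg {a, b}), MajWitness A a b θ

def IsAffEdge (A : UAlgebra σ) (a b : A.carrier) : Prop :=
  a ≠ b ∧ ∃ θ : Congruence (A.Sg {a, b}), AffWitness A a b θ

end UAlgebra

/-- The four types of edges. -/
inductive EdgeType where
  | unary | semilattice | majority | affine
deriving DecidableEq

namespace UAlgebra

variable {σ : Signature}

def HasEdgeOfType (A : UAlgebra σ) (τ : EdgeType) (a b : A.carrier) : Prop :=
  match τ with
  | .unary => A.IsUnaryEdge a b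
  | .semilattice => A.IsSLEdge a b
  | .majority => A.IsMajEdge a b
  | .affine => A.IsAffEdge a b

/-- `T`-restricted algebra: every edge has a type from `T`. -/
def Restricted (A : UAlgebra σ) (T : Set EdgeType) : Prop :=
  ∀ a b : A.carrier, A.IsEdge a b → ∃ τ ∈ T, A.HasEdgeOfType τ a b

/-- `A` omits type 1: no subalgebra of `A` has an edge of the unary type. -/
def OmitsType1 (A : UAlgebra σ) : Prop :=
  ∀ (S : Set A.carrier) (hS : A.IsClosed S) (a b : (A.subalg S hS).carrier),
    ¬ (A.subalg S hS).IsUnaryEdge a b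

/-- The union of the two `θ`-blocks of a thick edge, as a subset of `A`. -/
def edgeBlockUnion (A : UAlgebra σ) (a b : A.carrier) (θ : Congruence (A.Sg {a, b})) :
    Set A.carrier :=
  {x | ∃ hx : x ∈ A.ClosureSet {a, b},
    θ.rel ⟨x, hx⟩ (A.sgA a b) ∨ θ.rel ⟨x, hx⟩ (A.sgB a b)}

/-- Smooth algebra: for every semilattice- or majority-type edge with a witnessing
maximal congruence, the union of the two blocks is a subuniverse. -/
def IsSmooth (A : UAlgebra σ) : Prop :=
  ∀ (a b : A.carrier) (θ : Congruence (A.Sg {a, b})),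
    (SLWitness A a b θ ∨ MajWitness A a b θ) → A.IsClosed (A.edgeBlockUnion a b θ)

def SemilatticeFree (A : UAlgebra σ) : Prop := ∀ a b : A.carrier, ¬ A.IsSLEdge a b
def MajorityFree (A : UAlgebra σ) : Prop := ∀ a b : A.carrier, ¬ A.IsMajEdge a b
def AffineFree (A : UAlgebra σ) : Prop := ∀ a b : A.carrier, ¬ A.IsAffEdge a b

/-- Thin semilattice edge. -/
def IsThinSLEdge (A : UAlgebra σ) (a b : A.carrier) : Prop :=
  ∃ t : Term σ 2, t.eval A ![a, a] = a ∧ t.eval A ![a, b] = b ∧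
    t.eval A ![b, a] = b ∧ t.eval A ![b, b] = b

/-- Undirected thin majority edge: some term operation is majority on `{a, b}`. -/
def IsUndirThinMajEdge (A : UAlgebra σ) (a b : A.carrier) : Prop :=
  ∃ t : Term σ 3, IsMajorityOn (fun x y z => t.eval A ![x, y, z]) {a, b}

/-- Mal'tsev edge: some term operation is Mal'tsev on `{a, b}`. -/
def IsMaltsevEdge (A : UAlgebra σ) (a b : A.carrier) : Prop :=
  ∃ t : Term σ 3, IsMaltsevOn (fun x y z => t.eval A ![x, y, z]) {a, b}

/-- The class of all quotients of subalgebras of `A`. -/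
def QuotSub (A : UAlgebra σ) : Set (UAlgebra σ) :=
  {B | ∃ (S : Set A.carrier) (hS : A.IsClosed S)
        (θ : Congruence (A.subalg S hS)), B = (A.subalg S hS).quot θ}

end UAlgebra

/-- The class of all quotients of subalgebras of the algebras of a class. -/
def QuotSubClass {σ : Signature} (K : Set (UAlgebra σ)) : Set (UAlgebra σ) :=
  {B | ∃ A ∈ K, B ∈ UAlgebra.QuotSub A}

/-- A ternary term satisfies the majority condition relative to a class `𝒦`. -/
def MajorityCondition {σ : Signature} (𝒦 : Set (UAlgebra σ)) (t : Term σ 3) : Prop :=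
  (∀ B ∈ 𝒦, ∀ x y : B.carrier,
    t.eval B ![x, t.eval B ![x, y, y], t.eval B ![x, y, y]] = t.eval B ![x, y, y]) ∧
  (∀ B ∈ 𝒦, ∀ (a b : B.carrier) (θ : UAlgebra.Congruence (B.Sg {a, b})),
    a ≠ b → UAlgebra.MajWitness B a b θ →
    IsMajorityOn (fun x y z => t.eval ((B.Sg {a, b}).quot θ) ![x, y, z])
      {B.qa a b θ, B.qb a b θ})

/-- A ternary term satisfies the minority condition relative to a class `𝒦`. -/
def MinorityCondition {σ : Signature} (𝒦 : Set (UAlgebra σ)) (t : Term σ 3) : Prop :=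
  (∀ B ∈ 𝒦, ∀ x y : B.carrier,
    t.eval B ![t.eval B ![x, y, y], y, y] = t.eval B ![x, y, y]) ∧
  (∀ B ∈ 𝒦, ∀ (a b : B.carrier) (θ : UAlgebra.Congruence (B.Sg {a, b})),
    a ≠ b → UAlgebra.AffWitness B a b θ →
    IsMaltsevOn (fun x y z => t.eval ((B.Sg {a, b}).quot θ) ![x, y, z])
      {B.qa a b θ, B.qb a b θ})

/-- Thin majority edge relative to a class `𝒦`. -/
def IsThinMajEdge {σ : Signature} (𝒦 : Set (UAlgebra σ)) (A : UAlgebra σ)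
    (a b : A.carrier) : Prop :=
  ∀ t : Term σ 3, MajorityCondition 𝒦 t →
    b ∈ A.ClosureSet {a, t.eval A ![a, b, b]} ∧
    b ∈ A.ClosureSet {a, t.eval A ![b, a, b]} ∧
    b ∈ A.ClosureSet {a, t.eval A ![b, b, a]}

/-- Thin affine edge relative to a class `𝒦` (with respect to some fixed term
operation satisfying the minority condition). -/
def IsThinAffEdge {σ : Signature} (𝒦 : Set (UAlgebra σ)) (A : UAlgebra σ)
    (a b : A.carrier) : Prop :=
  (∃ t : Term σ 3, MinorityCondition 𝒦 t ∧ t.eval A ![b, a, a] = b) ∧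
  ∀ t : Term σ 3, MinorityCondition 𝒦 t → b ∈ A.ClosureSet {a, t.eval A ![a, a, b]}

namespace UAlgebra

variable {σ : Signature}

/-- Reachability in the digraph `Gs(A)` of thin semilattice edges. -/
def sReach (A : UAlgebra σ) : A.carrier → A.carrier → Prop :=
  Relation.ReflTransGen (fun x y => A.IsThinSLEdge x y)

/-- A maximal element of `Gs(A)`: an element of a maximal strongly connected
component. -/
def IsMaxElem (A : UAlgebra σ) (a : A.carrier) : Prop :=
  ∀ b, A.sReach a b → A.sReach b a

/-- A maximal component of `Gs(A)`: the strongly connected component of a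
maximal element. -/
def IsMaxComponent (A : UAlgebra σ) (C : Set A.carrier) : Prop :=
  ∃ a, A.IsMaxElem a ∧ C = {b | A.sReach a b ∧ A.sReach b a}

end UAlgebra

/-- An arc of the digraph `Gas(A)`: a thin semilattice or thin affine edge. -/
def asStep {σ : Signature} (𝒦 : Set (UAlgebra σ)) (A : UAlgebra σ)
    (x y : A.carrier) : Prop :=
  A.IsThinSLEdge x y ∨ IsThinAffEdge 𝒦 A x y

/-- Reachability in `Gas(A)`. -/
def asReach {σ : Signature} (𝒦 : Set (UAlgebra σ)) (A : UAlgebra σ) :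
    A.carrier → A.carrier → Prop :=
  Relation.ReflTransGen (asStep 𝒦 A)

/-- An as-maximal element: an element of an as-component. -/
def IsAsMaxElem {σ : Signature} (𝒦 : Set (UAlgebra σ)) (A : UAlgebra σ)
    (a : A.carrier) : Prop :=
  ∀ b, asReach 𝒦 A a b → asReach 𝒦 A b a

/-- An as-component of `A`: a maximal strongly connected component of `Gas(A)`. -/
def IsAsComponent {σ : Signature} (𝒦 : Set (UAlgebra σ)) (A : UAlgebra σ)
    (C : Set A.carrier) : Prop :=
  ∃ a, IsAsMaxElem 𝒦 A a ∧ C = {b | asReach 𝒦 A a b ∧ asReach 𝒦 A b a}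

namespace UAlgebra

variable {σ : Signature}

/-- Binary direct product. -/
def prod (A B : UAlgebra σ) : UAlgebra σ where
  carrier := A.carrier × B.carrier
  interp f x := (A.interp f fun j => (x j).1, B.interp f fun j => (x j).2)

/-- Direct product of a family. -/
def pi {ι : Type} (A : ι → UAlgebra σ) : UAlgebra σ where
  carrier := ∀ i, (A i).carrier
  interp f x := fun i => (A i).interp f fun j => x j i

/-- Homomorphism of similar algebras. -/
def IsHom (A B : UAlgebra σ) (φ : A.carrier → B.carrier) : Prop :=
  ∀ (f : σ.ops) (x : Fin (σ.arity f) → A.carrier),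
    φ (A.interp f x) = B.interp f fun j => φ (x j)

/-- Simple algebra: only the equality and full congruences. -/
def IsSimple (A : UAlgebra σ) : Prop :=
  ∀ θ : Congruence A, (∀ x y, θ.rel x y ↔ x = y) ∨ θ.IsFull

/-- Maximal generated algebra: generated by one of its maximal components. -/
def MaximalGenerated (A : UAlgebra σ) : Prop :=
  ∃ C : Set A.carrier, A.IsMaxComponent C ∧ A.ClosureSet C = Set.univ

/-- The number of subalgebras (nonempty closed subsets) of an algebra. -/
noncomputable def numSubalgebras (A : UAlgebra σ) : ℕ :=
  Nat.card {S : Set A.carrier // S.Nonempty ∧ A.IsClosed S}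

end UAlgebra

/-- A (k+3)-ary term is an edge term for a class `𝒦`. -/
def IsEdgeTermFor {σ : Signature} (𝒦 : Set (UAlgebra σ)) {k : ℕ}
    (t : Term σ (k + 3)) : Prop :=
  ∀ A ∈ 𝒦, ∀ x y : A.carrier,
    t.eval A (fun i => if i.val ≤ 1 then y else x) = x ∧
    t.eval A (fun i => if i.val = 0 ∨ i.val = 2 then y else x) = x ∧
    ∀ j : Fin (k + 3), 3 ≤ j.val →
      t.eval A (Function.update (fun _ => x) j y) = x

/-- A finite class has few subproducts. -/
def FewSubproducts {σ : Signature} (K : Set (UAlgebra σ)) : Prop :=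
  ∃ p : Polynomial ℕ, ∀ (n : ℕ) (A : Fin n → UAlgebra σ), (∀ i, A i ∈ K) →
    UAlgebra.numSubalgebras (UAlgebra.pi A) ≤ 2 ^ (p.eval n)

/-- `g_K` is bounded by a polynomial: every subalgebra of an `n`-fold product
of members of `K` has a generating set of polynomial size. -/
def PolyGenerated {σ : Signature} (K : Set (UAlgebra σ)) : Prop :=
  ∃ p : Polynomial ℕ, ∀ (n : ℕ) (A : Fin n → UAlgebra σ), (∀ i, A i ∈ K) →
    ∀ S : Set (UAlgebra.pi A).carrier, S.Nonempty → (UAlgebra.pi A).IsClosed S →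
      ∃ G : Set (UAlgebra.pi A).carrier, G ⊆ S ∧ G.Finite ∧
        G.ncard ≤ p.eval n ∧ (UAlgebra.pi A).ClosureSet G = S

namespace Term

variable {σ : Signature}

/-- Simultaneous substitution of terms for variables. -/
def subst {n m : ℕ} : Term σ n → (Fin n → Term σ m) → Term σ m
  | .var i, s => s i
  | .app f ts, s => .app f fun j => (ts j).subst s

theorem eval_subst (A : UAlgebra σ) {n m : ℕ} (t : Term σ n) (s : Fin n → Term σ m)
    (x : Fin m → A.carrier) : (t.subst s).eval A x = t.eval A fun i => (s i).eval A x := by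
  induction t with
  | var i => rfl
  | app f ts ih => simp only [subst, eval, ih]

theorem eval_subst_two (A : UAlgebra σ) {m : ℕ} (t : Term σ 2) (p q : Term σ m)
    (x : Fin m → A.carrier) :
    (t.subst ![p, q]).eval A x = t.eval A ![p.eval A x, q.eval A x] := by
  rw [eval_subst]
  congr 1
  funext i
  fin_cases i <;> rfl

/-- The `k`-fold iterate of a binary term in its second variable. -/
def iter (t : Term σ 2) : ℕ → Term σ 2
  | 0 => .var 1
  | k + 1 => t.subst ![.var 0, t.iter k]

theorem eval_iter (A : UAlgebra σ) (t : Term σ 2) (k : ℕ) (x y : A.carrier) :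
    (t.iter k).eval A ![x, y] = (fun z => t.eval A ![x, z])^[k] y := by
  induction k with
  | zero => rfl
  | succ k ih =>
    rw [Function.iterate_succ_apply', ← ih, iter, eval_subst_two]
    rfl

end Term

/-- Some positive iterate of a finite family of self-maps is idempotent. -/
theorem exists_iterate_idempotent {α β : Type} [Finite α] [Finite β] (F : α → β → β) :
    ∃ k, 0 < k ∧ ∀ x y, (F x)^[k] ((F x)^[k] y) = (F x)^[k] y := by
  obtain ⟨i, j, hij, h⟩ : ∃ i j, i < j ∧ (fun x => (F x)^[i]) = fun x => (F x)^[j] := by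
    obtain ⟨i, j, hne, h⟩ := Finite.exists_ne_map_eq_of_infinite fun (n : ℕ) x => (F x)^[n]
    rcases lt_or_gt_of_ne hne with hl | hl
    · exact ⟨i, j, hl, h⟩
    · exact ⟨j, i, hl, h.symm⟩
  obtain ⟨p, rfl⟩ := Nat.exists_eq_add_of_lt hij
  have hp : ∀ x m, i ≤ m → (F x)^[m + (p + 1)] = (F x)^[m] := by
    intro x m hm
    obtain ⟨d, rfl⟩ := Nat.exists_eq_add_of_le hm
    have hx : (F x)^[i + p + 1] = (F x)^[i] := (congrFun h x).symm
    rw [show i + d + (p + 1) = d + (i + p + 1) by ring, Function.iterate_add, hx,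
      ← Function.iterate_add, Nat.add_comm d i]
  have hq : ∀ x r m, i ≤ m → (F x)^[m + r * (p + 1)] = (F x)^[m] := by
    intro x r
    induction r with
    | zero => intro m _; simp
    | succ r ih =>
      intro m hm
      rw [Nat.succ_mul, ← Nat.add_assoc, hp x _ (by omega), ih m hm]
  refine ⟨(i + 1) * (p + 1), by positivity, fun x y => ?_⟩
  rw [← Function.iterate_add_apply, hq x (i + 1) _ (by nlinarith)]

namespace UAlgebra

variable {σ : Signature}

theorem Idempotent.eval {A : UAlgebra σ} (hA : A.Idempotent) {n : ℕ} (t : Term σ n)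
    (a : A.carrier) : t.eval A (fun _ => a) = a := by
  induction t with
  | var i => rfl
  | app f ts ih => simp only [Term.eval, ih, hA f a]

theorem Idempotent.eval_two {A : UAlgebra σ} (hA : A.Idempotent) (t : Term σ 2)
    (a : A.carrier) : t.eval A ![a, a] = a := by
  rw [show (![a, a] : Fin 2 → A.carrier) = fun _ => a by funext i; fin_cases i <;> rfl]
  exact hA.eval t a

theorem IsHom.eval {A B : UAlgebra σ} {φ : A.carrier → B.carrier} (h : IsHom A B φ) {n : ℕ}
    (t : Term σ n) (x : Fin n → A.carrier) :
    φ (t.eval A x) = t.eval B fun i => φ (x i) := by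
  induction t with
  | var i => rfl
  | app f ts ih => simp only [Term.eval, h f, ih]

theorem IsHom.eval_two {A B : UAlgebra σ} {φ : A.carrier → B.carrier} (h : IsHom A B φ)
    (t : Term σ 2) (x y : A.carrier) : φ (t.eval A ![x, y]) = t.eval B ![φ x, φ y] := by
  rw [h.eval]
  congr 1
  funext i
  fin_cases i <;> rfl

theorem IsHom.eval_three {A B : UAlgebra σ} {φ : A.carrier → B.carrier} (h : IsHom A B φ)
    (t : Term σ 3) (x y z : A.carrier) :
    φ (t.eval A ![x, y, z]) = t.eval B ![φ x, φ y, φ z] := by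
  rw [h.eval]
  congr 1
  funext i
  fin_cases i <;> rfl

theorem Idempotent.of_surjective {A B : UAlgebra σ} (hA : A.Idempotent)
    {φ : A.carrier → B.carrier} (h : IsHom A B φ) (hs : Function.Surjective φ) :
    B.Idempotent := by
  intro f b
  obtain ⟨a, rfl⟩ := hs b
  rw [← h f fun _ => a, hA]

theorem Idempotent.subalg {A : UAlgebra σ} (hA : A.Idempotent) {S : Set A.carrier}
    (hS : A.IsClosed S) : (A.subalg S hS).Idempotent :=
  fun f a => Subtype.ext (hA f a.1)

theorem Idempotent.pi {ι : Type} {A : ι → UAlgebra σ} (hA : ∀ i, (A i).Idempotent) :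
    (UAlgebra.pi A).Idempotent :=
  fun f a => funext fun i => hA i f (a i)

theorem isHom_subtype_val {A : UAlgebra σ} {S : Set A.carrier} (hS : A.IsClosed S) :
    IsHom (A.subalg S hS) A Subtype.val := fun _ _ => rfl

theorem IsHom.comp {A B C : UAlgebra σ} {ψ : B.carrier → C.carrier} {φ : A.carrier → B.carrier}
    (hψ : IsHom B C ψ) (hφ : IsHom A B φ) : IsHom A C (ψ ∘ φ) := by
  intro f x
  simp only [Function.comp_apply, hφ f, hψ f]

/-- The canonical projection onto a quotient. -/
def quotMk (A : UAlgebra σ) (θ : Congruence A) (x : A.carrier) : (A.quot θ).carrier :=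
  Quotient.mk θ.toSetoid x

theorem quotMk_eq_iff {A : UAlgebra σ} {θ : Congruence A} {x y : A.carrier} :
    A.quotMk θ x = A.quotMk θ y ↔ θ.rel x y := Quotient.eq (r := θ.toSetoid)

theorem quotMk_surjective {A : UAlgebra σ} (θ : Congruence A) : Function.Surjective (A.quotMk θ) :=
  Quotient.mk_surjective

theorem isHom_quotMk (A : UAlgebra σ) (θ : Congruence A) : IsHom A (A.quot θ) (A.quotMk θ) := by
  intro f x
  refine quotMk_eq_iff.2 (θ.compat f _ _ fun j => ?_)
  exact θ.symm (Quotient.mk_out (s := θ.toSetoid) (x j))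

theorem Closure.mem {A : UAlgebra σ} {S T : Set A.carrier} (hT : A.IsClosed T) (h : S ⊆ T) :
    A.ClosureSet S ⊆ T := by
  intro x hx
  induction hx with
  | base ha => exact h ha
  | app f x _ ih => exact hT f x ih

theorem IsClosed.eval {A : UAlgebra σ} {S : Set A.carrier} (hS : A.IsClosed S) {n : ℕ}
    (t : Term σ n) {x : Fin n → A.carrier} (hx : ∀ i, x i ∈ S) : t.eval A x ∈ S := by
  induction t with
  | var i => exact hx i
  | app f ts ih => exact hS f _ ih

theorem mem_closure_pair {A : UAlgebra σ} {a b x : A.carrier} (h : x ∈ A.ClosureSet {a, b}) :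
    ∃ t : Term σ 2, t.eval A ![a, b] = x := by
  induction h with
  | base h =>
    rcases h with rfl | h
    · exact ⟨.var 0, rfl⟩
    · exact ⟨.var 1, (show _ = _ from h).symm⟩
  | app f x _ ih =>
    choose t ht using ih
    exact ⟨.app f t, by simp only [Term.eval, ht]⟩

theorem isClosed_univ (A : UAlgebra σ) : A.IsClosed Set.univ := fun _ _ _ => trivial

theorem left_mem_closure {A : UAlgebra σ} (a b : A.carrier) : a ∈ A.ClosureSet {a, b} :=
  Closure.base (Set.mem_insert a {b})

theorem right_mem_closure {A : UAlgebra σ} (a b : A.carrier) : b ∈ A.ClosureSet {a, b} :=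
  Closure.base (Set.mem_insert_iff.mpr (Or.inr rfl))

/-- In the subalgebra generated by `a` and `b` every element is a binary term in `a`, `b`. -/
theorem sg_generated {A : UAlgebra σ} {a b : A.carrier} (x : (A.Sg {a, b}).carrier) :
    ∃ t : Term σ 2, t.eval (A.Sg {a, b}) ![A.sgA a b, A.sgB a b] = x := by
  obtain ⟨t, ht⟩ := mem_closure_pair x.2
  exact ⟨t, Subtype.ext (((isHom_subtype_val _).eval_two t _ _).trans ht)⟩

theorem Congruence.isClosed_class {A : UAlgebra σ} (hA : A.Idempotent) (θ : Congruence A)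
    (x : A.carrier) : A.IsClosed {y | θ.rel x y} := by
  intro f y hy
  have := θ.compat f (fun _ => x) y hy
  rwa [hA] at this

theorem Congruence.isFull_of_rel {A : UAlgebra σ} (hA : A.Idempotent) {a b : A.carrier}
    {θ : Congruence (A.Sg {a, b})} (h : θ.rel (A.sgA a b) (A.sgB a b)) : θ.IsFull := by
  have key : ∀ x, θ.rel (A.sgA a b) x := by
    intro x
    obtain ⟨t, rfl⟩ := sg_generated x
    refine (θ.isClosed_class (hA.subalg _) _).eval t fun i => ?_
    fin_cases i
    · exact θ.refl _
    · exact h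
  exact fun x y => θ.trans (θ.symm (key x)) (key y)

/-- Every proper congruence of a finite algebra is contained in a maximal one. -/
theorem Congruence.exists_le_isMaximal {A : UAlgebra σ} [Finite A.carrier] (θ : Congruence A)
    (h : ¬ θ.IsFull) : ∃ η : Congruence A, θ.le η ∧ η.IsMaximal := by
  classical
  let c : Congruence A → ℕ := fun η => {p : A.carrier × A.carrier | η.rel p.1 p.2}.ncard
  let P : ℕ → Prop := fun m => ∃ η : Congruence A, θ.le η ∧ ¬ η.IsFull ∧ c η = m
  have hb : ∀ m, P m → m ≤ Nat.card (A.carrier × A.carrier) := by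
    rintro m ⟨η, -, -, rfl⟩
    exact Set.ncard_le_card _
  have hP : ∃ m, P m := ⟨c θ, θ, fun _ _ h => h, h, rfl⟩
  obtain ⟨m, ⟨η, h1, h2, h3⟩, hm⟩ : ∃ m, P m ∧ ∀ k, P k → k ≤ m := by
    obtain ⟨m0, h0⟩ := hP
    exact ⟨Nat.findGreatest P (Nat.card (A.carrier × A.carrier)),
      Nat.findGreatest_spec (hb _ h0) h0, fun k hk => Nat.le_findGreatest (hb k hk) hk⟩
  refine ⟨η, h1, h2, fun ζ hζ hf x y hxy => ?_⟩
  have hle := hm _ ⟨ζ, fun x y h => hζ x y (h1 x y h), hf, rfl⟩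
  have hsub : {p : A.carrier × A.carrier | η.rel p.1 p.2} ⊆ {p | ζ.rel p.1 p.2} :=
    fun p hp => hζ _ _ hp
  have heq := Set.eq_of_subset_of_ncard_le hsub (hle.trans h3.ge) (Set.toFinite _)
  have : (x, y) ∈ {p : A.carrier × A.carrier | ζ.rel p.1 p.2} := hxy
  rwa [← heq] at this

/-- The kernel of a homomorphism. -/
def kerCong {A B : UAlgebra σ} {φ : A.carrier → B.carrier} (h : IsHom A B φ) :
    Congruence A where
  rel x y := φ x = φ y
  refl _ := rfl
  symm := Eq.symm
  trans := Eq.trans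
  compat f x y hxy := by simp only [h f, hxy]

/-- A homomorphism whose kernel contains `θ` factors through the quotient by `θ`. -/
def quotLift {A B : UAlgebra σ} (θ : Congruence A) (φ : A.carrier → B.carrier)
    (hle : ∀ x y, θ.rel x y → φ x = φ y) : (A.quot θ).carrier → B.carrier :=
  Quotient.lift φ hle

theorem isHom_quotLift {A B : UAlgebra σ} {θ : Congruence A} {φ : A.carrier → B.carrier}
    (h : IsHom A B φ) (hle : ∀ x y, θ.rel x y → φ x = φ y) :
    IsHom (A.quot θ) B (quotLift θ φ hle) := by
  intro f x
  choose y hy using fun j => quotMk_surjective θ (x j)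
  obtain rfl : (fun j => A.quotMk θ (y j)) = x := funext hy
  rw [← isHom_quotMk A θ f y]
  exact h f y

theorem quotLift_kerCong_injective {A B : UAlgebra σ} {φ : A.carrier → B.carrier}
    (h : IsHom A B φ) :
    Function.Injective (quotLift (kerCong h) φ fun _ _ hxy => hxy) := by
  intro p q hpq
  obtain ⟨x, rfl⟩ := quotMk_surjective _ p
  obtain ⟨y, rfl⟩ := quotMk_surjective _ q
  exact quotMk_eq_iff.2 hpq

section Transfer

variable {A B : UAlgebra σ} {φ : A.carrier → B.carrier} {p q : A.carrier}

theorem IsHom.isSemilatticeOn (h : IsHom A B φ) {t : Term σ 2}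
    (ht : IsSemilatticeOn (fun x y => t.eval A ![x, y]) {p, q}) :
    IsSemilatticeOn (fun x y => t.eval B ![x, y]) {φ p, φ q} := by
  obtain ⟨h1, h2, h3⟩ := ht
  have e : ∀ x ∈ ({φ p, φ q} : Set B.carrier), ∃ y ∈ ({p, q} : Set A.carrier), φ y = x := by
    rintro x (rfl | rfl)
    · exact ⟨p, by simp, rfl⟩
    · exact ⟨q, by simp, rfl⟩
  refine ⟨fun x hx => ?_, fun x hx y hy => ?_, fun x hx y hy z hz => ?_⟩
  · obtain ⟨x', hx', rfl⟩ := e x hx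
    exact (h.eval_two t x' x').symm.trans (congrArg φ (h1 x' hx'))
  · obtain ⟨x', hx', rfl⟩ := e x hx
    obtain ⟨y', hy', rfl⟩ := e y hy
    simpa only [h.eval_two] using congrArg φ (h2 x' hx' y' hy')
  · obtain ⟨x', hx', rfl⟩ := e x hx
    obtain ⟨y', hy', rfl⟩ := e y hy
    obtain ⟨z', hz', rfl⟩ := e z hz
    simpa only [h.eval_two] using congrArg φ (h3 x' hx' y' hy' z' hz')

theorem IsHom.isSemilatticeOn_of_injective (h : IsHom A B φ) (hi : Function.Injective φ)
    {t : Term σ 2} (ht : IsSemilatticeOn (fun x y => t.eval B ![x, y]) {φ p, φ q}) :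
    IsSemilatticeOn (fun x y => t.eval A ![x, y]) {p, q} := by
  obtain ⟨h1, h2, h3⟩ := ht
  have e : ∀ x ∈ ({p, q} : Set A.carrier), φ x ∈ ({φ p, φ q} : Set B.carrier) := by
    rintro x (rfl | rfl) <;> simp
  refine ⟨fun x hx => hi ?_, fun x hx y hy => hi ?_, fun x hx y hy z hz => hi ?_⟩
  · simpa only [h.eval_two] using h1 _ (e x hx)
  · simpa only [h.eval_two] using h2 _ (e x hx) _ (e y hy)
  · simpa only [h.eval_two] using h3 _ (e x hx) _ (e y hy) _ (e z hz)

theorem IsHom.isMajorityOn (h : IsHom A B φ) {t : Term σ 3}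
    (ht : IsMajorityOn (fun x y z => t.eval A ![x, y, z]) {p, q}) :
    IsMajorityOn (fun x y z => t.eval B ![x, y, z]) {φ p, φ q} := by
  have e : ∀ x ∈ ({φ p, φ q} : Set B.carrier), ∃ y ∈ ({p, q} : Set A.carrier), φ y = x := by
    rintro x (rfl | rfl)
    · exact ⟨p, by simp, rfl⟩
    · exact ⟨q, by simp, rfl⟩
  intro x hx y hy
  obtain ⟨x', hx', rfl⟩ := e x hx
  obtain ⟨y', hy', rfl⟩ := e y hy
  obtain ⟨h1, h2, h3⟩ := ht x' hx' y' hy'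
  simp only [← h.eval_three]
  exact ⟨congrArg φ h1, congrArg φ h2, congrArg φ h3⟩

theorem IsHom.isMajorityOn_of_injective (h : IsHom A B φ) (hi : Function.Injective φ)
    {t : Term σ 3} (ht : IsMajorityOn (fun x y z => t.eval B ![x, y, z]) {φ p, φ q}) :
    IsMajorityOn (fun x y z => t.eval A ![x, y, z]) {p, q} := by
  have e : ∀ x ∈ ({p, q} : Set A.carrier), φ x ∈ ({φ p, φ q} : Set B.carrier) := by
    rintro x (rfl | rfl) <;> simp
  intro x hx y hy
  obtain ⟨h1, h2, h3⟩ := ht _ (e x hx) _ (e y hy)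
  simp only [← h.eval_three] at h1 h2 h3
  exact ⟨hi h1, hi h2, hi h3⟩

end Transfer

/-- If `f(p, q) = f(q, p) = q` in a homomorphic image, then this situation can be lifted
with an exact equality for a suitable term and a suitable preimage of `q`. -/
theorem exists_thin_lift {B Q : UAlgebra σ} [Finite B.carrier] (hB : B.Idempotent)
    {φ : B.carrier → Q.carrier} (hφ : IsHom B Q φ) (p r : B.carrier) (f : Term σ 2)
    (h1 : f.eval Q ![φ p, φ r] = φ r) (h2 : f.eval Q ![φ r, φ p] = φ r) :
    ∃ (t : Term σ 2) (s : B.carrier),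
      φ s = φ r ∧ t.eval B ![p, s] = s ∧ t.eval B ![s, p] = s := by
  have h3 : f.eval Q ![φ r, φ r] = φ r := by
    rw [← hφ.eval_two, hB.eval_two]
  obtain ⟨k, hk, hk'⟩ := exists_iterate_idempotent fun x y => f.eval B ![x, y]
  simp only [← Term.eval_iter] at hk'
  set f' := f.iter k
  have e1 : f'.eval Q ![φ p, φ r] = φ r := by
    rw [Term.eval_iter]
    exact Function.iterate_fixed h1 k
  have e2 : f'.eval Q ![φ r, φ p] = φ r := by
    obtain ⟨m, rfl⟩ := Nat.exists_eq_succ_of_ne_zero hk.ne'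
    rw [Term.eval_iter, Function.iterate_succ_apply, h2]
    exact Function.iterate_fixed h3 m
  set t := f'.subst ![(.var 0 : Term σ 2), f'.subst ![(.var 1 : Term σ 2), .var 0]]
  have ht : ∀ (A : UAlgebra σ) (x y : A.carrier),
      t.eval A ![x, y] = f'.eval A ![x, f'.eval A ![y, x]] := by
    intro A x y
    simp only [t, Term.eval_subst_two]
    rfl
  obtain ⟨m, hm, hm'⟩ := exists_iterate_idempotent fun x y => t.eval B ![x, y]
  set s0 := f'.eval B ![p, r]
  have hs0 : f'.eval B ![p, s0] = s0 := hk' p r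
  have hfix : ∀ j, f'.eval B ![p, (fun y => t.eval B ![p, y])^[j] s0] =
      (fun y => t.eval B ![p, y])^[j] s0 := by
    intro j
    induction j with
    | zero => exact hs0
    | succ j _ =>
      rw [Function.iterate_succ_apply']
      simp only [ht]
      exact hk' _ _
  set s := (fun y => t.eval B ![p, y])^[m] s0
  refine ⟨t.iter m, s, ?_, ?_, ?_⟩
  · have : s = (t.iter m).eval B ![p, s0] := (Term.eval_iter B t m p s0).symm
    rw [this, hφ.eval_two, hφ.eval_two, e1, Term.eval_iter]
    refine Function.iterate_fixed ?_ m
    rw [ht, e2, e1]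
  · rw [Term.eval_iter]
    exact hm' p s0
  · obtain ⟨l, rfl⟩ := Nat.exists_eq_succ_of_ne_zero hm.ne'
    rw [Term.eval_iter, Function.iterate_succ_apply]
    have : t.eval B ![s, p] = s := by
      rw [ht, hfix, hB.eval_two]
    rw [this]
    exact Function.iterate_fixed (hB.eval_two t s) l

end UAlgebra

namespace UAlgebra

variable {σ : Signature}

/-- The functions generated by a family `G` of functions under the pointwise operations. -/
inductive Gen (A : UAlgebra σ) {X : Type} (G : Set (X → A.carrier)) : (X → A.carrier) → Prop
  | base {g : X → A.carrier} : g ∈ G → Gen A G g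
  | app (f : σ.ops) (g : Fin (σ.arity f) → X → A.carrier) :
      (∀ j, Gen A G (g j)) → Gen A G fun x => A.interp f fun j => g j x

/-- Term operations whose variables are indexed by `ι`. -/
def IsTermOp (A : UAlgebra σ) (ι : Type) (F : (ι → A.carrier) → A.carrier) : Prop :=
  Gen A (Set.range fun (i : ι) (x : ι → A.carrier) => x i) F

/-- Binary term operations. -/
def IsTermOp₂ (A : UAlgebra σ) (F : A.carrier → A.carrier → A.carrier) : Prop :=
  Gen A {Prod.fst, Prod.snd} fun p : A.carrier × A.carrier => F p.1 p.2

/-- Unary polynomial operations. -/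
def IsPol (A : UAlgebra σ) (m : A.carrier → A.carrier) : Prop :=
  Gen A (insert id (Set.range (Function.const _))) m

/-- Binary polynomial operations. -/
def IsPol₂ (A : UAlgebra σ) (H : A.carrier → A.carrier → A.carrier) : Prop :=
  Gen A ({Prod.fst, Prod.snd} ∪ Set.range (Function.const _))
    fun p : A.carrier × A.carrier => H p.1 p.2

section Gen

variable {A : UAlgebra σ} {X Y ι : Type} {G : Set (X → A.carrier)} {G' : Set (Y → A.carrier)}

theorem Gen.comp {h : X → A.carrier} (hh : Gen A G h) (k : Y → X)
    (hk : ∀ g ∈ G, Gen A G' fun y => g (k y)) : Gen A G' fun y => h (k y) := by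
  induction hh with
  | base hg => exact hk _ hg
  | app f g _ ih => exact Gen.app f (fun j y => g j (k y)) ih

theorem Gen.term {n : ℕ} (t : Term σ n) {g : Fin n → X → A.carrier} (hg : ∀ i, Gen A G (g i)) :
    Gen A G fun x => t.eval A fun i => g i x := by
  induction t with
  | var i => exact hg i
  | app f ts ih => exact Gen.app f _ ih

theorem isTermOp_of_term {n : ℕ} (t : Term σ n) : IsTermOp A (Fin n) (t.eval A) :=
  Gen.term t fun i => Gen.base ⟨i, rfl⟩

theorem isTermOp_interp (A : UAlgebra σ) (f : σ.ops) :
    IsTermOp A (Fin (σ.arity f)) (A.interp f) :=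
  Gen.app f _ fun j => Gen.base ⟨j, rfl⟩

theorem IsTermOp.gen {F : (ι → A.carrier) → A.carrier} (hF : IsTermOp A ι F)
    {g : ι → X → A.carrier} (hg : ∀ i, Gen A G (g i)) : Gen A G fun x => F fun i => g i x :=
  Gen.comp hF (fun x i => g i x) (by rintro _ ⟨i, rfl⟩; exact hg i)

theorem IsTermOp₂.gen {F : A.carrier → A.carrier → A.carrier} (hF : IsTermOp₂ A F)
    {g h : X → A.carrier} (hg : Gen A G g) (hh : Gen A G h) :
    Gen A G fun x => F (g x) (h x) :=
  Gen.comp hF (fun x => (g x, h x)) (by rintro _ (rfl | rfl); exacts [hg, hh])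

theorem IsTermOp₂.fst : IsTermOp₂ A fun x _ => x := Gen.base (Or.inl rfl)

theorem IsTermOp₂.snd : IsTermOp₂ A fun _ y => y := Gen.base (Or.inr rfl)

theorem isTermOp₂_of_term (t : Term σ 2) : IsTermOp₂ A fun x y => t.eval A ![x, y] := by
  have := (isTermOp_of_term (A := A) t).gen (g := ![Prod.fst, Prod.snd])
    (G := {Prod.fst, Prod.snd}) (by intro i; fin_cases i; exacts [IsTermOp₂.fst, IsTermOp₂.snd])
  refine (congrArg (Gen A _) (funext fun p => congrArg (t.eval A) (funext fun i => ?_))).mp this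
  fin_cases i <;> rfl

theorem IsTermOp₂.exists_term {F : A.carrier → A.carrier → A.carrier} (hF : IsTermOp₂ A F) :
    ∃ t : Term σ 2, ∀ x y, t.eval A ![x, y] = F x y := by
  suffices h : ∀ k : A.carrier × A.carrier → A.carrier, Gen A {Prod.fst, Prod.snd} k →
      ∃ t : Term σ 2, ∀ x y, t.eval A ![x, y] = k (x, y) from h _ hF
  intro k hk
  induction hk with
  | base hg =>
    rcases hg with rfl | rfl
    · exact ⟨.var 0, fun _ _ => rfl⟩
    · exact ⟨.var 1, fun _ _ => rfl⟩
  | app f g _ ih =>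
    choose t ht using ih
    exact ⟨.app f t, fun x y => by simp only [Term.eval, ht]⟩

theorem IsPol.id : IsPol A fun x => x := Gen.base (Or.inl rfl)

theorem IsPol.const (a : A.carrier) : IsPol A fun _ => a := Gen.base (Or.inr ⟨a, rfl⟩)

theorem IsPol₂.const (a : A.carrier) : IsPol₂ A fun _ _ => a := Gen.base (Or.inr ⟨a, rfl⟩)

theorem IsPol₂.fst : IsPol₂ A fun x _ => x := Gen.base (Or.inl (Or.inl rfl))

theorem IsPol₂.snd : IsPol₂ A fun _ y => y := Gen.base (Or.inl (Or.inr rfl))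

theorem IsPol.comp {m m' : A.carrier → A.carrier} (hm : IsPol A m) (hm' : IsPol A m') :
    IsPol A fun x => m (m' x) :=
  Gen.comp hm m' (by
    rintro _ (rfl | ⟨a, rfl⟩)
    exacts [hm', IsPol.const a])

theorem IsPol.comp₂ {m : A.carrier → A.carrier} {H : A.carrier → A.carrier → A.carrier}
    (hm : IsPol A m) (hH : IsPol₂ A H) : IsPol₂ A fun x y => m (H x y) :=
  Gen.comp hm (fun p : A.carrier × A.carrier => H p.1 p.2) (by
    rintro _ (rfl | ⟨a, rfl⟩)
    exacts [hH, IsPol₂.const a])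

theorem IsPol₂.comp {H m m' : A.carrier → A.carrier → A.carrier}
    (hH : IsPol₂ A H) (hm : IsPol₂ A m) (hm' : IsPol₂ A m') :
    IsPol₂ A fun x y => H (m x y) (m' x y) :=
  Gen.comp hH (fun p : A.carrier × A.carrier => (m p.1 p.2, m' p.1 p.2)) (by
    rintro _ ((rfl | rfl) | ⟨a, rfl⟩)
    exacts [hm, hm', IsPol₂.const a])

theorem IsPol₂.comp₁ {H : A.carrier → A.carrier → A.carrier} {m m' : A.carrier → A.carrier}
    (hH : IsPol₂ A H) (hm : IsPol A m) (hm' : IsPol A m') :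
    IsPol A fun x => H (m x) (m' x) :=
  Gen.comp hH (fun x => (m x, m' x)) (by
    rintro _ ((rfl | rfl) | ⟨a, rfl⟩)
    exacts [hm, hm', IsPol.const a])

theorem IsPol₂.flip {H : A.carrier → A.carrier → A.carrier} (hH : IsPol₂ A H) :
    IsPol₂ A fun x y => H y x := hH.comp .snd .fst

theorem IsPol₂.left {H : A.carrier → A.carrier → A.carrier} (hH : IsPol₂ A H)
    (y : A.carrier) : IsPol A fun x => H x y := hH.comp₁ .id (.const y)

theorem IsPol₂.right {H : A.carrier → A.carrier → A.carrier} (hH : IsPol₂ A H)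
    (x : A.carrier) : IsPol A (H x) := hH.comp₁ (.const x) .id

theorem IsPol₂.both {H : A.carrier → A.carrier → A.carrier} {m m' : A.carrier → A.carrier}
    (hH : IsPol₂ A H) (hm : IsPol A m) (hm' : IsPol A m') :
    IsPol₂ A fun x y => H (m x) (m' y) := hH.comp (hm.comp₂ .fst) (hm'.comp₂ .snd)

theorem IsPol₂.iterate {H : A.carrier → A.carrier → A.carrier} (hH : IsPol₂ A H) (k : ℕ) :
    IsPol₂ A fun x y => (H x)^[k] y := by
  induction k with
  | zero => exact .snd
  | succ k ih =>
    simp only [Function.iterate_succ_apply']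
    exact hH.comp .fst ih

theorem IsPol.iterate {m : A.carrier → A.carrier} (hm : IsPol A m) (k : ℕ) : IsPol A m^[k] := by
  induction k with
  | zero => exact .id
  | succ k ih =>
    rw [Function.iterate_succ']
    exact hm.comp ih

theorem IsTermOp.isPol {F : (ι → A.carrier) → A.carrier} (hF : IsTermOp A ι F)
    {m : ι → A.carrier → A.carrier} (hm : ∀ i, IsPol A (m i)) :
    IsPol A fun x => F fun i => m i x := hF.gen hm

theorem IsTermOp.isPol₂ {F : (ι → A.carrier) → A.carrier} (hF : IsTermOp A ι F)
    {m : ι → A.carrier → A.carrier → A.carrier} (hm : ∀ i, IsPol₂ A (m i)) :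
    IsPol₂ A fun x y => F fun i => m i x y := hF.gen hm

/-- A relation preserved by the basic operations is preserved by generated functions. -/
theorem Gen.rel {R : A.carrier → A.carrier → Prop}
    (hR : ∀ (f : σ.ops) (x y : Fin (σ.arity f) → A.carrier),
      (∀ j, R (x j) (y j)) → R (A.interp f x) (A.interp f y))
    {h : X → A.carrier} (hh : Gen A G h) {x y : X} (hxy : ∀ g ∈ G, R (g x) (g y)) :
    R (h x) (h y) := by
  induction hh with
  | base hg => exact hxy _ hg
  | app f g _ ih => exact hR f _ _ ih

theorem Congruence.isPol (θ : Congruence A) {m : A.carrier → A.carrier} (hm : IsPol A m)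
    {x y : A.carrier} (h : θ.rel x y) : θ.rel (m x) (m y) :=
  Gen.rel θ.compat hm (by
    rintro _ (rfl | ⟨a, rfl⟩)
    exacts [h, θ.refl a])

theorem IsTermOp.apply_const (hA : A.Idempotent) {F : (ι → A.carrier) → A.carrier}
    (hF : IsTermOp A ι F) (a : A.carrier) : F (fun _ => a) = a := by
  have := hF.rel (R := fun x _ => x = a) (x := fun _ => a) (y := fun _ => a)
    (fun f x y h => by rw [funext h, hA]) (by rintro _ ⟨i, rfl⟩; rfl)
  exact this

/-- Generated functions can be lifted along surjective homomorphisms. -/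
theorem Gen.lift {B Q : UAlgebra σ} {φ : B.carrier → Q.carrier} (hφ : IsHom B Q φ)
    {G : Set (X → Q.carrier)} {G' : Set (Y → B.carrier)} (κ : Y → X)
    (hG : ∀ g ∈ G, ∃ g', Gen B G' g' ∧ ∀ y, φ (g' y) = g (κ y))
    {h : X → Q.carrier} (hh : Gen Q G h) : ∃ h', Gen B G' h' ∧ ∀ y, φ (h' y) = h (κ y) := by
  induction hh with
  | base hg => exact hG _ hg
  | app f g _ ih =>
    choose g' h1 h2 using ih
    exact ⟨_, Gen.app f g' h1, fun y => by simp only [hφ f, h2]⟩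

theorem IsPol.lift {B Q : UAlgebra σ} {φ : B.carrier → Q.carrier} (hφ : IsHom B Q φ)
    (hs : Function.Surjective φ) {m : Q.carrier → Q.carrier} (hm : IsPol Q m) :
    ∃ m', IsPol B m' ∧ ∀ x, φ (m' x) = m (φ x) :=
  Gen.lift hφ φ (by
    rintro _ (rfl | ⟨a, rfl⟩)
    · exact ⟨_, IsPol.id, fun _ => rfl⟩
    · obtain ⟨b, rfl⟩ := hs a
      exact ⟨_, IsPol.const b, fun _ => rfl⟩) hm

theorem IsPol₂.lift {B Q : UAlgebra σ} {φ : B.carrier → Q.carrier} (hφ : IsHom B Q φ)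
    (hs : Function.Surjective φ) {H : Q.carrier → Q.carrier → Q.carrier} (hH : IsPol₂ Q H) :
    ∃ H', IsPol₂ B H' ∧ ∀ x y, φ (H' x y) = H (φ x) (φ y) := by
  obtain ⟨h', h1, h2⟩ := Gen.lift (G' := {Prod.fst, Prod.snd} ∪ Set.range (Function.const _)) hφ
    (fun p : B.carrier × B.carrier => (φ p.1, φ p.2)) (by
    rintro _ ((rfl | rfl) | ⟨a, rfl⟩)
    · exact ⟨_, IsPol₂.fst, fun _ => rfl⟩
    · exact ⟨_, IsPol₂.snd, fun _ => rfl⟩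
    · obtain ⟨b, rfl⟩ := hs a
      exact ⟨_, IsPol₂.const b, fun _ => rfl⟩) hH
  exact ⟨fun x y => h' (x, y), h1, fun x y => h2 (x, y)⟩

end Gen

/-- A preorder preserved by a function in each coordinate is preserved by the function. -/
theorem rel_of_update {α : Type} {ι : Type} [Fintype ι] [DecidableEq ι] {R : α → α → Prop}
    (hrefl : ∀ x, R x x) (htrans : ∀ x y z, R x y → R y z → R x z) (F : (ι → α) → α)
    (h : ∀ x i v, R (x i) v → R (F x) (F (Function.update x i v))) (x y : ι → α)
    (hxy : ∀ i, R (x i) (y i)) : R (F x) (F y) := by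
  have key : ∀ s : Finset ι, R (F x) (F (s.piecewise y x)) := by
    intro s
    induction s using Finset.induction_on with
    | empty => simpa using hrefl _
    | insert i s hi ih =>
      rw [Finset.piecewise_insert]
      refine htrans _ _ _ ih (h _ i _ ?_)
      rw [Finset.piecewise_eq_of_notMem _ _ _ hi]
      exact hxy i
  simpa using key Finset.univ

/-- A preorder preserved by unary polynomials is preserved by the basic operations. -/
theorem interp_rel {A : UAlgebra σ} {R : A.carrier → A.carrier → Prop}
    (hrefl : ∀ x, R x x) (htrans : ∀ x y z, R x y → R y z → R x z)
    (hpol : ∀ m, IsPol A m → ∀ x y, R x y → R (m x) (m y)) (f : σ.ops)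
    (x y : Fin (σ.arity f) → A.carrier) (hxy : ∀ j, R (x j) (y j)) :
    R (A.interp f x) (A.interp f y) := by
  refine rel_of_update hrefl htrans (A.interp f) (fun x i v hv => ?_) x y hxy
  have hm : IsPol A fun w => A.interp f (Function.update x i w) := by
    refine (isTermOp_interp A f).isPol (m := fun j w => Function.update x i w j) fun j => ?_
    by_cases hj : j = i
    · subst hj
      simpa only [Function.update_self] using IsPol.id
    · simpa only [Function.update_of_ne hj] using IsPol.const (x j)
  have := hpol _ hm _ _ hv
  rwa [Function.update_eq_self] at this

/-- In a simple algebra the polynomial images of a pair `p ≠ q` connect all elements. -/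
theorem IsSimple.connected {Q : UAlgebra σ} (hQ : Q.IsSimple) {p q : Q.carrier} (hpq : p ≠ q)
    {β : Type*} (F : Q.carrier → β) (hF : ∀ m, IsPol Q m → F (m p) = F (m q))
    (x y : Q.carrier) : F x = F y := by
  let U : Q.carrier → Q.carrier → Prop := fun x y => ∃ m, IsPol Q m ∧ m p = x ∧ m q = y
  have hpol : ∀ m, IsPol Q m → ∀ x y, Relation.EqvGen U x y → Relation.EqvGen U (m x) (m y) := by
    intro m hm x y h
    induction h with
    | rel x y h =>
      obtain ⟨m', h1, rfl, rfl⟩ := h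
      exact .rel _ _ ⟨_, hm.comp h1, rfl, rfl⟩
    | refl x => exact .refl _
    | symm x y _ ih => exact .symm _ _ ih
    | trans x y z _ _ ih1 ih2 => exact .trans _ _ _ ih1 ih2
  let θ : Congruence Q :=
    { rel := Relation.EqvGen U
      refl := .refl
      symm := .symm _ _
      trans := .trans _ _ _
      compat := interp_rel .refl (fun x y z => .trans x y z) hpol }
  have hfull : θ.IsFull := by
    refine (hQ θ).resolve_left fun h => hpq ((h p q).1 (.rel _ _ ⟨_, .id, rfl, rfl⟩))
  have hxy : Relation.EqvGen U x y := hfull x y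
  induction hxy with
  | rel x y h =>
    obtain ⟨m, h1, rfl, rfl⟩ := h
    exact hF m h1
  | refl x => rfl
  | symm x y _ ih => exact ih.symm
  | trans x y z _ _ ih1 ih2 => exact ih1.trans ih2

/-- In a simple algebra distinct elements are separated by a nonconstant polynomial `e`
after applying a suitable polynomial. -/
theorem IsSimple.separate {Q : UAlgebra σ} (hQ : Q.IsSimple) {e : Q.carrier → Q.carrier}
    (hne : ∃ x y, e x ≠ e y) {x y : Q.carrier} (hxy : x ≠ y) :
    ∃ h, IsPol Q h ∧ e (h x) ≠ e (h y) := by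
  by_contra! hc
  obtain ⟨u, v, huv⟩ := hne
  exact huv (hQ.connected hxy e hc u v)

end UAlgebra

namespace UAlgebra

variable {σ : Signature}

/-- Some binary polynomial with values in `N` is independent of its second argument on `N` for
one value of the first argument in `N`, but not for another one. -/
def NonAbelianOn (Q : UAlgebra σ) (N : Set Q.carrier) : Prop :=
  ∃ P, IsPol₂ Q P ∧ (∀ s t, P s t ∈ N) ∧ ∃ u ∈ N, ∃ v ∈ N,
    (∀ s ∈ N, ∀ t ∈ N, P u s = P u t) ∧ ∃ s ∈ N, ∃ t ∈ N, P v s ≠ P v t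

/-- A range `N` of a nonconstant polynomial `e` such that every polynomial is constant or
injective on `N`. -/
structure IsMinRange (Q : UAlgebra σ) (e : Q.carrier → Q.carrier) (N : Set Q.carrier) :
    Prop where
  pol : IsPol Q e
  range_eq : Set.range e = N
  nonconst : ∃ x y, e x ≠ e y
  inj : ∀ m, IsPol Q m → ∀ s ∈ N, ∀ t ∈ N, m s ≠ m t → Set.InjOn m N

theorem exists_isMinRange {Q : UAlgebra σ} [Finite Q.carrier] (h : ∃ x y : Q.carrier, x ≠ y) :
    ∃ e N, IsMinRange Q e N := by
  classical
  let P : ℕ → Prop := fun k => ∃ e, IsPol Q e ∧ (∃ x y, e x ≠ e y) ∧ (Set.range e).ncard = k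
  have hP : ∃ k, P k := ⟨_, _, IsPol.id, h, rfl⟩
  obtain ⟨e, h1, h2, h3⟩ := Nat.find_spec hP
  refine ⟨e, Set.range e, h1, rfl, h2, ?_⟩
  rintro m hm _ ⟨s, rfl⟩ _ ⟨t, rfl⟩ hst
  have hle : Nat.find hP ≤ (m '' Set.range e).ncard := by
    refine Nat.find_min' hP ⟨_, hm.comp h1, ⟨s, t, hst⟩, ?_⟩
    rw [← Set.range_comp]
    rfl
  exact Set.injOn_of_ncard_image_eq
    (le_antisymm (Set.ncard_image_le (Set.toFinite _)) (h3 ▸ hle)) (Set.toFinite _)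

namespace IsMinRange

variable {Q : UAlgebra σ} {e : Q.carrier → Q.carrier} {N : Set Q.carrier}

theorem mem (h : IsMinRange Q e N) (x : Q.carrier) : e x ∈ N := h.range_eq ▸ ⟨x, rfl⟩

theorem exists_ne (h : IsMinRange Q e N) : ∃ p ∈ N, ∃ q ∈ N, p ≠ q := by
  obtain ⟨x, y, hxy⟩ := h.nonconst
  exact ⟨_, h.mem x, _, h.mem y, hxy⟩

theorem const_of_eq (h : IsMinRange Q e N) {m : Q.carrier → Q.carrier} (hm : IsPol Q m)
    {p q : Q.carrier} (hp : p ∈ N) (hq : q ∈ N) (hpq : p ≠ q) (heq : m p = m q) :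
    ∀ s ∈ N, ∀ t ∈ N, m s = m t := by
  intro s hs t ht
  by_contra hst
  exact hpq (h.inj m hm s hs t ht hst hp hq heq)

/-- In the absence of nonabelian behaviour, an equality `H x y = H x' y` on a polynomial
image `(x, x')` of a pair does not depend on `y`. -/
theorem eq_of_eq (h : IsMinRange Q e N) (hQ : Q.IsSimple) (hab : ¬ NonAbelianOn Q N)
    {p q : Q.carrier} (hp : p ∈ N) (hq : q ∈ N) (hpq : p ≠ q)
    {H : Q.carrier → Q.carrier → Q.carrier} (hH : IsPol₂ Q H) (hN : ∀ x y, H x y ∈ N)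
    {m : Q.carrier → Q.carrier} (hm : IsPol Q m) {y : Q.carrier}
    (hy : H (m p) y = H (m q) y) (y' : Q.carrier) : H (m p) y' = H (m q) y' := by
  have key := hQ.connected hpq (fun y => H (m p) y = H (m q) y) ?_ y y'
  · exact key.mp hy
  intro m' hm'
  have aux : ∀ p' ∈ N, ∀ q' ∈ N, H (m p) (m' p') = H (m q) (m' p') →
      H (m p) (m' q') = H (m q) (m' q') := by
    intro p' hp' q' hq' heq
    have hP : IsPol₂ Q fun s t => H (m t) (m' s) := (hH.both hm hm').flip
    have hc := h.const_of_eq (hP.right p') hp hq hpq heq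
    by_contra hne
    exact hab ⟨_, hP, fun s t => hN _ _, p', hp', q', hq', hc, p, hp, q, hq, hne⟩
  exact propext ⟨aux p hp q hq, aux q hq p hp⟩

/-- An algebra with a majority term on a pair is nonabelian. -/
theorem nonAbelianOn (h : IsMinRange Q e N) [Finite Q.carrier] (hQ : Q.IsSimple)
    {a b : Q.carrier} (hab : a ≠ b) {g : Term σ 3}
    (hg : IsMajorityOn (fun x y z => g.eval Q ![x, y, z]) {a, b}) : NonAbelianOn Q N := by
  by_contra hA
  obtain ⟨p, hp, q, hq, hpq⟩ := h.exists_ne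
  obtain ⟨k, hk, hkab⟩ := hQ.separate h.nonconst hab
  let H : Q.carrier → Q.carrier → Q.carrier := fun x y => e (k (g.eval Q ![x, y, a]))
  have hH : IsPol₂ Q H := by
    refine (h.pol.comp hk).comp₂ ?_
    have := (isTermOp_of_term (A := Q) g).isPol₂
      (m := ![fun x _ => x, fun _ y => y, fun _ _ => a]) (by
        intro i
        fin_cases i
        exacts [IsPol₂.fst, IsPol₂.snd, IsPol₂.const a])
    refine (congrArg (IsPol₂ Q) (funext fun x => funext fun y =>
      congrArg (g.eval Q) (funext fun i => ?_))).mp this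
    fin_cases i <;> rfl
  have hHN : ∀ x y, H x y ∈ N := fun x y => h.mem _
  have ha : a ∈ ({a, b} : Set Q.carrier) := by simp
  have hb : b ∈ ({a, b} : Set Q.carrier) := by simp
  have haa : H a a = e (k a) := congrArg (fun w => e (k w)) (hg a ha a ha).1
  have hab' : H a b = e (k a) := congrArg (fun w => e (k w)) (hg a ha b hb).2.1
  have hba : H b a = e (k a) := congrArg (fun w => e (k w)) (hg a ha b hb).2.2
  have hbb : H b b = e (k b) := congrArg (fun w => e (k w)) (hg b hb a ha).1
  obtain ⟨m, hm, hmne⟩ : ∃ m, IsPol Q m ∧ H (m p) b ≠ H (m q) b := by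
    by_contra! hc
    refine hkab ?_
    rw [← hab', ← hbb]
    exact hQ.connected hpq (fun x => H x b) hc a b
  obtain ⟨m', hm', hmne'⟩ : ∃ m, IsPol Q m ∧ H b (m p) ≠ H b (m q) := by
    by_contra! hc
    refine hkab ?_
    rw [← hba, ← hbb]
    exact hQ.connected hpq (fun x => H b x) hc a b
  let P : Q.carrier → Q.carrier → Q.carrier := fun s t => H (m s) (m' t)
  have hP : IsPol₂ Q P := hH.both hm hm'
  have hPN : ∀ s t, P s t ∈ N := fun s t => hHN _ _
  have hP1 : P p p ≠ P q p := fun heq =>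
    hmne (h.eq_of_eq hQ hA hp hq hpq hH hHN hm heq b)
  have hP2 : P p p ≠ P p q := fun heq =>
    hmne' (h.eq_of_eq hQ hA hp hq hpq hH.flip (fun x y => hHN y x) hm' heq b)
  have inj1 : ∀ u ∈ N, Set.InjOn (P u) N := by
    intro u hu
    by_contra hc
    have hcon : ∀ s ∈ N, ∀ t ∈ N, P u s = P u t := by
      by_contra! hne
      obtain ⟨s, hs, t, ht, hst⟩ := hne
      exact hc (h.inj _ (hP.right u) s hs t ht hst)
    exact hA ⟨P, hP, hPN, u, hu, p, hp, hcon, p, hp, q, hq, hP2⟩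
  have inj2 : ∀ u ∈ N, Set.InjOn (fun s => P s u) N := by
    intro u hu
    by_contra hc
    have hcon : ∀ s ∈ N, ∀ t ∈ N, P s u = P t u := by
      by_contra! hne
      obtain ⟨s, hs, t, ht, hst⟩ := hne
      exact hc (h.inj _ (hP.left u) s hs t ht hst)
    exact hA ⟨_, hP.flip, fun s t => hPN t s, u, hu, p, hp, hcon, p, hp, q, hq, hP1⟩
  obtain ⟨j, hj, hidem⟩ := exists_iterate_idempotent P
  obtain ⟨j, rfl⟩ := Nat.exists_eq_succ_of_ne_zero hj.ne'
  have hmaps : ∀ u, ∀ i, ∀ s ∈ N, (P u)^[i] s ∈ N := by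
    intro u i s hs
    cases i with
    | zero => exact hs
    | succ i =>
      rw [Function.iterate_succ_apply']
      exact hPN _ _
  have hinj : ∀ u ∈ N, ∀ i, Set.InjOn (P u)^[i] N := by
    intro u hu i
    induction i with
    | zero => exact fun _ _ _ _ h => h
    | succ i ih =>
      intro s hs t ht hst
      rw [Function.iterate_succ_apply', Function.iterate_succ_apply'] at hst
      exact ih hs ht (inj1 u hu (hmaps u i s hs) (hmaps u i t ht) hst)
  have hid : ∀ u ∈ N, ∀ s ∈ N, (P u)^[j + 1] s = s := fun u hu s hs =>
    hinj u hu _ (hmaps u _ s hs) hs (hidem u s)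
  let d : Q.carrier → Q.carrier → Q.carrier := fun s t => (P t)^[j] (P s p)
  have hd : IsPol₂ Q d := (hP.iterate j).comp .snd ((hP.left p).comp₂ .fst)
  have hdN : ∀ s t, d s t ∈ N := fun s t => hmaps _ _ _ (hPN _ _)
  have hdd : ∀ t ∈ N, d t t = p := by
    intro t ht
    change (P t)^[j] (P t p) = p
    rw [← Function.iterate_succ_apply]
    exact hid t ht p hp
  have hdinj : ∀ s ∈ N, ∀ s' ∈ N, ∀ t ∈ N, d s t = d s' t → s = s' := fun s hs s' hs' t ht heq =>
    inj2 p hp hs hs' (hinj t ht j (hPN _ _) (hPN _ _) heq)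
  let R : Q.carrier → Q.carrier → Q.carrier := fun x y => d (H a y) (H x y)
  have hR : IsPol₂ Q R := hd.comp ((hH.right a).comp₂ .snd) hH
  have hRN : ∀ x y, R x y ∈ N := fun x y => hdN _ _
  have hRa : ∀ y, R a y = p := fun y => hdd _ (hHN _ _)
  have hRb : R b a = R b b := by
    refine hQ.connected hpq (fun y => R b y) (fun m hm => ?_) a b
    exact h.eq_of_eq hQ hA hp hq hpq hR.flip (fun x y => hRN y x) hm
      (y := a) ((hRa _).trans (hRa _).symm) b
  have h1 : R b a = p := by
    change d (H a a) (H b a) = p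
    rw [haa, hba]
    exact hdd _ (h.mem _)
  have h2 : R b b = d (e (k a)) (e (k b)) := by
    change d (H a b) (H b b) = _
    rw [hab', hbb]
  refine hkab (hdinj _ (h.mem _) _ (h.mem _) _ (h.mem (k b)) ?_)
  rw [← h2, ← hRb, h1, hdd _ (h.mem _)]

end IsMinRange

/-- A nonconstant polynomial `e` with values in `{z, o}` together with a binary polynomial
that acts on `{z, o}` as the meet operation for `z < o`. -/
structure HasMeet (Q : UAlgebra σ) (z o : Q.carrier) (e : Q.carrier → Q.carrier)
    (M : Q.carrier → Q.carrier → Q.carrier) : Prop where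
  ne : z ≠ o
  pol : IsPol Q e
  mem : ∀ x, e x = z ∨ e x = o
  nonconst : ∃ x y, e x ≠ e y
  polM : IsPol₂ Q M
  zz : M z z = z
  zo : M z o = z
  oz : M o z = z
  oo : M o o = o

theorem IsMinRange.hasMeet {Q : UAlgebra σ} {e : Q.carrier → Q.carrier} {N : Set Q.carrier}
    (h : IsMinRange Q e N) [Finite Q.carrier] (hN : NonAbelianOn Q N) :
    ∃ z o M, HasMeet Q z o e M := by
  obtain ⟨P₀, hP₀, hP₀N, u, hu, v, hv, hconst, s₀, hs₀, t₀, ht₀, hst⟩ := hN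
  obtain ⟨k, hk, hidem⟩ := exists_iterate_idempotent P₀
  obtain ⟨k, rfl⟩ := Nat.exists_eq_succ_of_ne_zero hk.ne'
  let P : Q.carrier → Q.carrier → Q.carrier := fun x y => (P₀ x)^[k + 1] y
  have hP : IsPol₂ Q P := hP₀.iterate (k + 1)
  have hPN : ∀ s t, P s t ∈ N := fun s t => by
    change (P₀ s)^[k + 1] t ∈ N
    rw [Function.iterate_succ_apply']
    exact hP₀N _ _
  have hPid : ∀ s t, P s (P s t) = P s t := hidem
  have hmaps : ∀ u, ∀ i, ∀ s ∈ N, (P₀ u)^[i] s ∈ N := by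
    intro u i s hs
    cases i with
    | zero => exact hs
    | succ i =>
      rw [Function.iterate_succ_apply']
      exact hP₀N _ _
  have hinj₀ : Set.InjOn (P₀ v) N := h.inj _ (hP₀.right v) _ hs₀ _ ht₀ hst
  have hinj : ∀ i, Set.InjOn (P₀ v)^[i] N := by
    intro i
    induction i with
    | zero => exact fun _ _ _ _ h => h
    | succ i ih =>
      intro s hs t ht hst
      rw [Function.iterate_succ_apply', Function.iterate_succ_apply'] at hst
      exact ih hs ht (hinj₀ (hmaps v i s hs) (hmaps v i t ht) hst)
  have hPv : ∀ s ∈ N, P v s = s := fun s hs => hinj _ (hPN v s) hs (hidem v s)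
  let c := P u u
  have hc : c ∈ N := hPN _ _
  have hPu : ∀ s ∈ N, P u s = c := by
    intro s hs
    change (P₀ u)^[k + 1] s = (P₀ u)^[k + 1] u
    rw [Function.iterate_succ_apply, Function.iterate_succ_apply, hconst s hs u hu]
  have huv : u ≠ v := by
    rintro rfl
    exact hst (hconst _ hs₀ _ ht₀)
  have hPc : ∀ w ∈ N, P w c = c := fun w hw =>
    (h.const_of_eq (hP.left c) hu hv huv
      ((hPu c hc).trans (hPv c hc).symm) w hw u hu).trans (hPu c hc)
  have hval : ∀ w ∈ N, ∀ y ∈ N, P w y = c ∨ P w y = y := by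
    intro w hw y hy
    by_cases hi : Set.InjOn (P w) N
    · exact Or.inr (hi (hPN _ _) hy (hPid w y))
    · left
      have hcon : P w y = P w c := by
        by_contra hne
        exact hi (h.inj _ (hP.right w) y hy c hc hne)
      rw [hcon, hPc w hw]
  obtain ⟨y, hy, hyc⟩ : ∃ y ∈ N, y ≠ c := by
    obtain ⟨p, hp, q, hq, hpq⟩ := h.exists_ne
    by_cases hpc : p = c
    · exact ⟨q, hq, fun hqc => hpq (hpc.trans hqc.symm)⟩
    · exact ⟨p, hp, hpc⟩
  have hinjy : Set.InjOn (fun w => P w y) N := by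
    refine h.inj _ (hP.left y) u hu v hv ?_
    simp only [hPu y hy, hPv y hy]
    exact hyc.symm
  have htwo : ∀ w ∈ N, w = u ∨ w = v := by
    intro w hw
    rcases hval w hw y hy with h1 | h1
    · exact Or.inl (hinjy hw hu (h1.trans (hPu y hy).symm))
    · exact Or.inr (hinjy hw hv (h1.trans (hPv y hy).symm))
  have hN2 : ∀ w ∈ N, w = c ∨ w = y := by
    intro w hw
    rcases htwo c hc with h1 | h1 <;> rcases htwo y hy with h2 | h2 <;>
      rcases htwo w hw with h3 | h3 <;> grind
  rcases htwo c hc with hcu | hcv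
  · have hyv : y = v := (htwo y hy).resolve_left fun hyu => hyc (hyu.trans hcu.symm)
    refine ⟨c, y, P, hyc.symm, h.pol, fun x => hN2 _ (h.mem x), h.nonconst, hP,
      hPc c hc, ?_, hPc y hy, ?_⟩
    · rw [hcu, hPu y hy, hcu]
    · nth_rw 1 [hyv]
      exact hPv y hy
  · have hyu : y = u := (htwo y hy).resolve_right fun hyv => hyc (hyv.trans hcv.symm)
    have e1 : P c y = y := by
      nth_rw 1 [hcv]
      exact hPv y hy
    have e2 : P y y = c := by
      nth_rw 1 [hyu]
      exact hPu y hy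
    refine ⟨c, y, fun s t => P (P s y) t, hyc.symm, h.pol, fun x => hN2 _ (h.mem x), h.nonconst,
      hP.comp ((hP.left y).comp₂ .fst) .snd, ?_, ?_, ?_, ?_⟩
    · simp only [e1, hPc y hy]
    · simp only [e1, e2]
    · simp only [e2, hPc c hc]
    · simp only [e2, e1]

/-- A simple algebra with a majority term on a pair has a meet polynomial. -/
theorem exists_hasMeet {Q : UAlgebra σ} [Finite Q.carrier] (hQ : Q.IsSimple) {a b : Q.carrier}
    (hab : a ≠ b) {g : Term σ 3}
    (hg : IsMajorityOn (fun x y z => g.eval Q ![x, y, z]) {a, b}) :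
    ∃ z o e M, HasMeet Q z o e M := by
  obtain ⟨e, N, h⟩ := exists_isMinRange ⟨a, b, hab⟩
  obtain ⟨z, o, M, hM⟩ := h.hasMeet (h.nonAbelianOn hQ hab hg)
  exact ⟨z, o, e, M, hM⟩

end UAlgebra

namespace UAlgebra

variable {σ : Signature}

namespace HasMeet

variable {B Q : UAlgebra σ} {z o : Q.carrier} {e : Q.carrier → Q.carrier}
  {M : Q.carrier → Q.carrier → Q.carrier}

theorem exists_colored (h : HasMeet Q z o e M) (hQ : Q.IsSimple) {φ : B.carrier → Q.carrier}
    (hφ : IsHom B Q φ) (hs : Function.Surjective φ) (η : Congruence B)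
    (hη : ∃ p q, η.rel p q ∧ φ p ≠ φ q) : ∃ p q, η.rel p q ∧ φ p = z ∧ φ q = o := by
  obtain ⟨p, q, hpq, hne⟩ := hη
  obtain ⟨k, hk, hke⟩ := hQ.separate h.nonconst hne
  obtain ⟨m, hm, hme⟩ := (h.pol.comp hk).lift hφ hs
  have hrel := η.isPol hm hpq
  rcases h.mem (k (φ p)) with h1 | h1 <;> rcases h.mem (k (φ q)) with h2 | h2
  · exact absurd (h1.trans h2.symm) hke
  · exact ⟨_, _, hrel, (hme p).trans h1, (hme q).trans h2⟩
  · exact ⟨_, _, η.symm hrel, (hme q).trans h2, (hme p).trans h1⟩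
  · exact absurd (h1.trans h2.symm) hke

/-- If the meet of two congruences lies below the kernel of a homomorphism onto `Q`, but
neither of them does, then no polynomial of `Q` acts on `{z, o}` as the join operation. -/
theorem no_join (h : HasMeet Q z o e M) (hQ : Q.IsSimple) [Finite B.carrier]
    {φ : B.carrier → Q.carrier} (hφ : IsHom B Q φ) (hs : Function.Surjective φ)
    {η₁ η₂ : Congruence B} (hinf : ∀ x y, η₁.rel x y → η₂.rel x y → φ x = φ y)
    (h₁ : ∃ p q, η₁.rel p q ∧ φ p ≠ φ q) (h₂ : ∃ p q, η₂.rel p q ∧ φ p ≠ φ q)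
    {J : Q.carrier → Q.carrier → Q.carrier} (hJ : IsPol₂ Q J) (hzz : J z z = z)
    (hzo : J z o = o) (hoz : J o z = o) (hoo : J o o = o) : False := by
  obtain ⟨p, q, hpq, hp, hq⟩ := h.exists_colored hQ hφ hs η₁ h₁
  obtain ⟨p', q', hpq', hp', hq'⟩ := h.exists_colored hQ hφ hs η₂ h₂
  obtain ⟨M', hM', hMφ⟩ := h.polM.lift hφ hs
  obtain ⟨J', hJ', hJφ⟩ := hJ.lift hφ hs
  have hδ : IsPol B fun x => J' x x := hJ'.comp₁ .id .id
  obtain ⟨k, hk, hidem⟩ := exists_iterate_idempotent fun (_ : Unit) x => J' x x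
  obtain ⟨k, rfl⟩ := Nat.exists_eq_succ_of_ne_zero hk.ne'
  have hδz : ∀ i x, φ x = z → φ ((fun x => J' x x)^[i] x) = z := by
    intro i
    induction i with
    | zero => exact fun _ hx => hx
    | succ i ih =>
      intro x hx
      rw [Function.iterate_succ_apply]
      exact ih _ (by rw [hJφ, hx, hzz])
  have hδo : ∀ i x, φ x = o → φ ((fun x => J' x x)^[i] x) = o := by
    intro i
    induction i with
    | zero => exact fun _ hx => hx
    | succ i ih =>
      intro x hx
      rw [Function.iterate_succ_apply]
      exact ih _ (by rw [hJφ, hx, hoo])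
  let D : B.carrier → B.carrier := (fun x => J' x x)^[k + 1]
  have hD : IsPol B D := hδ.iterate (k + 1)
  let u := D (M' q q')
  let x := D (M' p q')
  let y := D (M' q p')
  have hxu : η₁.rel x u := η₁.isPol hD (η₁.isPol (hM'.left q') hpq)
  have hyu : η₂.rel y u := η₂.isPol hD (η₂.isPol (hM'.right q) hpq')
  have hu : φ u = o := hδo _ _ (by rw [hMφ, hq, hq', h.oo])
  have hx : φ x = z := hδz _ _ (by rw [hMφ, hp, hq', h.zo])
  have hy : φ y = z := hδz _ _ (by rw [hMφ, hq, hp', h.oz])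
  let J₂ : B.carrier → B.carrier → B.carrier := fun s t => (fun x => J' x x)^[k] (J' s t)
  have hJ₂ : IsPol₂ B J₂ := (hδ.iterate k).comp₂ hJ'
  have hJ₂u : J₂ u u = u := hidem () (M' q q')
  have hJ₂z : ∀ s t, φ s = z → φ t = z → φ (J₂ s t) = z := fun s t hs ht =>
    hδz _ _ (by rw [hJφ, hs, ht, hzz])
  have hJ₂o : ∀ s t, φ s = z → φ t = o → φ (J₂ s t) = o := fun s t hs ht =>
    hδo _ _ (by rw [hJφ, hs, ht, hzo])
  have hJ₂o' : ∀ s t, φ s = o → (φ t = z ∨ φ t = o) → φ (J₂ s t) = o := by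
    rintro s t hs (ht | ht)
    · exact hδo _ _ (by rw [hJφ, hs, ht, hoz])
    · exact hδo _ _ (by rw [hJφ, hs, ht, hoo])
  obtain ⟨l, hl, hlid⟩ := exists_iterate_idempotent J₂
  let T : B.carrier → B.carrier → B.carrier := fun s t => (J₂ s)^[l] t
  have hT : IsPol₂ B T := hJ₂.iterate l
  have hTu : T u u = u := Function.iterate_fixed hJ₂u l
  have hTz : ∀ s t, φ s = z → φ t = z → φ (T s t) = z := by
    intro s t hs
    change φ t = z → φ ((J₂ s)^[l] t) = z
    clear hl hlid hT hTu T
    induction l generalizing t with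
    | zero => exact id
    | succ l ih =>
      intro ht
      rw [Function.iterate_succ_apply]
      exact ih _ (hJ₂z s t hs ht)
  have hTo : ∀ s t, φ s = z → φ t = o → φ (T s t) = o := by
    intro s t hs
    change φ t = o → φ ((J₂ s)^[l] t) = o
    clear hl hlid hT hTu hTz T
    induction l generalizing t with
    | zero => exact id
    | succ l ih =>
      intro ht
      rw [Function.iterate_succ_apply]
      exact ih _ (hJ₂o s t hs ht)
  have hTuy : φ (T u y) = o := by
    obtain ⟨l, rfl⟩ := Nat.exists_eq_succ_of_ne_zero hl.ne'
    change φ ((J₂ u)^[l + 1] y) = o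
    rw [Function.iterate_succ_apply]
    have h1 := hJ₂o' u y hu (Or.inl hy)
    generalize J₂ u y = w at h1
    clear hl hlid hT hTu hTz hTo T
    induction l generalizing w with
    | zero => exact h1
    | succ l ih =>
      rw [Function.iterate_succ_apply]
      exact ih _ (hJ₂o' u w hu (Or.inr h1))
  have hfix : T u (T u y) = T u y := hlid u y
  have r1 : η₂.rel (T u y) u := by
    have := η₂.isPol (hT.right u) hyu
    rwa [hTu] at this
  have r2 : η₁.rel (T x (T u y)) (T x y) := by
    have s1 := η₁.isPol (hT.left (T u y)) hxu
    rw [hfix] at s1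
    exact η₁.trans s1 (η₁.symm (η₁.isPol (hT.left y) hxu))
  have r3 : η₂.rel (T x (T u y)) (T x y) :=
    η₂.isPol (hT.right x) (η₂.trans r1 (η₂.symm hyu))
  have := hinf _ _ r2 r3
  rw [hTo x _ hx hTuy, hTz x y hx hy] at this
  exact h.ne this.symm

end HasMeet

/-- A preorder generated by the polynomial images of the pair `(z, o)`. -/
def polLE (Q : UAlgebra σ) (z o : Q.carrier) : Q.carrier → Q.carrier → Prop :=
  Relation.ReflTransGen fun x y => ∃ m, IsPol Q m ∧ m z = x ∧ m o = y

/-- No polynomial acts on `{z, o}` as the join operation. -/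
def NoJoin (Q : UAlgebra σ) (z o : Q.carrier) : Prop :=
  ∀ J, IsPol₂ Q J → J z z = z → J z o = o → J o z = o → J o o = o → False

theorem polLE_isPol {Q : UAlgebra σ} {z o : Q.carrier} (m : Q.carrier → Q.carrier)
    (hm : IsPol Q m) (x y : Q.carrier) (h : polLE Q z o x y) : polLE Q z o (m x) (m y) := by
  induction h with
  | refl => exact .refl
  | tail _ hstep ih =>
    obtain ⟨m', h1, rfl, rfl⟩ := hstep
    exact ih.tail ⟨_, hm.comp h1, rfl, rfl⟩

namespace HasMeet

variable {Q : UAlgebra σ} {z o : Q.carrier} {e : Q.carrier → Q.carrier}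
  {M : Q.carrier → Q.carrier → Q.carrier}

theorem mono_pol (h : HasMeet Q z o e M) (hJ : NoJoin Q z o) {m : Q.carrier → Q.carrier}
    (hm : IsPol Q m) (hv : ∀ x, m x = z ∨ m x = o) {x y : Q.carrier} (hxy : polLE Q z o x y)
    (hx : m x = o) : m y = o := by
  induction hxy with
  | refl => exact hx
  | tail _ hstep ih =>
    obtain ⟨m', h1, rfl, rfl⟩ := hstep
    refine (hv _).resolve_left fun hz => ?_
    have hn : IsPol Q fun x => m (m' x) := hm.comp h1
    refine hJ _ (hn.comp₂ (h.polM.both hn hn)) ?_ ?_ ?_ ?_ <;>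
      simp only [ih, hz, h.oo, h.zz, h.zo, h.oz]

theorem antisymm (h : HasMeet Q z o e M) (hQ : Q.IsSimple) (hJ : NoJoin Q z o)
    {x y : Q.carrier} (hxy : polLE Q z o x y) (hyx : polLE Q z o y x) : x = y := by
  by_contra hne
  obtain ⟨k, hk, hke⟩ := hQ.separate h.nonconst hne
  have key := @h.mono_pol σ Q z o e M hJ _ (h.pol.comp hk) fun x => h.mem (k x)
  rcases h.mem (k x) with h1 | h1 <;> rcases h.mem (k y) with h2 | h2
  · exact hke (h1.trans h2.symm)
  · exact hke ((key hyx h2).trans h2.symm)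
  · exact hke (h1.trans (key hxy h1).symm)
  · exact hke (h1.trans h2.symm)

/-- A binary polynomial with values in `{z, o}` that equals `o` at two opposite corners of a
rectangle equals `o` at the bottom corner. -/
theorem grid (h : HasMeet Q z o e M) (hJ : NoJoin Q z o)
    {H : Q.carrier → Q.carrier → Q.carrier} (hH : IsPol₂ Q H) (hv : ∀ x y, H x y = z ∨ H x y = o)
    {x y x' y' : Q.carrier} (hxy : polLE Q z o x y) (hxy' : polLE Q z o x' y')
    (h1 : H y x' = o) (h2 : H x y' = o) : H x x' = o := by
  have hmono : ∀ x {s t}, polLE Q z o s t → H x s = o → H x t = o := fun x _ _ hst =>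
    h.mono_pol hJ (hH.right x) (hv x) hst
  have hmono' : ∀ x {s t}, polLE Q z o s t → H s x = o → H t x = o := fun x _ _ hst =>
    h.mono_pol hJ (hH.left x) (fun s => hv s x) hst
  have single : ∀ m m', IsPol Q m → IsPol Q m' → H (m o) (m' z) = o → H (m z) (m' o) = o →
      H (m z) (m' z) = o := by
    intro m m' hm hm' h1 h2
    refine (hv _ _).resolve_left fun hz => hJ _ (hH.both hm hm') hz h2 h1 ?_
    exact hmono' _ (.single ⟨m, hm, rfl, rfl⟩) h2
  have row : ∀ m', IsPol Q m' → ∀ x y, polLE Q z o x y → H y (m' z) = o → H x (m' o) = o →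
      H x (m' z) = o := by
    intro m' hm' x y hxy
    induction hxy using Relation.ReflTransGen.head_induction_on with
    | refl => exact fun h1 _ => h1
    | head hstep _ ih =>
      obtain ⟨m, hm, rfl, rfl⟩ := hstep
      intro h1 h2
      exact single m m' hm hm' (ih h1 (hmono' _ (.single ⟨m, hm, rfl, rfl⟩) h2)) h2
  induction hxy' using Relation.ReflTransGen.head_induction_on with
  | refl => exact h2
  | head hstep htail ih =>
    obtain ⟨m', hm', rfl, rfl⟩ := hstep
    exact row m' hm' x y hxy h1 (ih (hmono y (.single ⟨m', hm', rfl, rfl⟩) h1))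

end HasMeet

end UAlgebra

namespace UAlgebra

variable {σ : Signature}

/-- A subalgebra has a two-element quotient all of whose operations are projections. -/
def HasSetQuot (X : UAlgebra σ) : Prop :=
  ∃ S : Set X.carrier, X.IsClosed S ∧ ∃ χ : X.carrier → Prop, (∃ x ∈ S, χ x) ∧ (∃ x ∈ S, ¬ χ x) ∧
    ∀ f : σ.ops, ∃ i : Fin (σ.arity f), ∀ e : Fin (σ.arity f) → X.carrier,
      (∀ j, e j ∈ S) → (χ (X.interp f e) ↔ χ (e i))

/-- The tuple that equals `y` on `I` and `x` elsewhere. -/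
def mix {ι α : Type} [DecidableEq ι] (x y : α) (I : Finset ι) : ι → α :=
  fun i => if i ∈ I then y else x

theorem mix_empty {ι α : Type} [DecidableEq ι] (x y : α) :
    mix x y (∅ : Finset ι) = fun _ => x := by
  funext i
  simp [mix]

/-- A partial order preserved by the operations and a separating family of up-sets for which
the families `{I | h (F (mix x y I))}` are closed under intersections. -/
structure IsMeetOrder (Q : UAlgebra σ) [PartialOrder Q.carrier] (𝓗 : Set (Q.carrier → Prop)) :
    Prop where
  idem : Q.Idempotent
  interp_le : ∀ (f : σ.ops) (x y : Fin (σ.arity f) → Q.carrier), (∀ j, x j ≤ y j) →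
    Q.interp f x ≤ Q.interp f y
  mono : ∀ h ∈ 𝓗, ∀ x y, x ≤ y → h x → h y
  inter : ∀ h ∈ 𝓗, ∀ (ι : Type) [DecidableEq ι] (F : (ι → Q.carrier) → Q.carrier),
    IsTermOp Q ι F → ∀ x y, x ≤ y → ∀ I J : Finset ι,
      h (F (mix x y I)) → h (F (mix x y J)) → h (F (mix x y (I ∩ J)))
  comp : ∀ h ∈ 𝓗, ∀ m, IsPol Q m → (fun w => h (m w)) ∈ 𝓗
  sep : ∀ x y, x ≠ y → ∃ h ∈ 𝓗, ¬ (h x ↔ h y)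
  conn : ∀ P : Q.carrier → Prop, (∀ x y, x ≤ y → (P x ↔ P y)) → ∀ x y, P x → P y

theorem IsTermOp₂.isTermOp {A : UAlgebra σ} {ι : Type} {t : A.carrier → A.carrier → A.carrier}
    (ht : IsTermOp₂ A t) {F G : (ι → A.carrier) → A.carrier} (hF : IsTermOp A ι F)
    (hG : IsTermOp A ι G) : IsTermOp A ι fun v => t (F v) (G v) := ht.gen hF hG

theorem IsTermOp.var {A : UAlgebra σ} {ι : Type} (i : ι) : IsTermOp A ι fun v => v i :=
  Gen.base ⟨i, rfl⟩

namespace IsMeetOrder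

variable {Q : UAlgebra σ} [PartialOrder Q.carrier] {𝓗 : Set (Q.carrier → Prop)}
  {ι κ : Type} [DecidableEq ι] [DecidableEq κ]

theorem termOp_le (hQ : IsMeetOrder Q 𝓗) {ι : Type} {F : (ι → Q.carrier) → Q.carrier}
    (hF : IsTermOp Q ι F) {x y : ι → Q.carrier} (h : ∀ i, x i ≤ y i) : F x ≤ F y :=
  hF.rel hQ.interp_le (by rintro _ ⟨i, rfl⟩; exact h i)

theorem termOp₂_le (hQ : IsMeetOrder Q 𝓗) {F : Q.carrier → Q.carrier → Q.carrier}
    (hF : IsTermOp₂ Q F) {x y x' y' : Q.carrier} (h : x ≤ x') (h' : y ≤ y') : F x y ≤ F x' y' :=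
  hF.rel (x := (x, y)) (y := (x', y')) hQ.interp_le (by rintro _ (rfl | rfl); exacts [h, h'])

theorem termOp₂_self (hQ : IsMeetOrder Q 𝓗) {F : Q.carrier → Q.carrier → Q.carrier}
    (hF : IsTermOp₂ Q F) (x : Q.carrier) : F x x = x :=
  (hF.isTermOp (.var ()) (.var ())).apply_const (ι := Unit) hQ.idem x

theorem mix_mono {x y : Q.carrier} (hxy : x ≤ y) {I J : Finset ι} (h : I ⊆ J) (i : ι) :
    mix x y I i ≤ mix x y J i := by
  unfold mix
  by_cases h1 : i ∈ I
  · simp [h1, h h1]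
  · by_cases h2 : i ∈ J <;> simp [h1, h2, hxy]

theorem le_mix {x y : Q.carrier} (hxy : x ≤ y) (I : Finset ι) (i : ι) : x ≤ mix x y I i := by
  unfold mix
  split <;> simp [hxy]

theorem mix_le {x y : Q.carrier} (hxy : x ≤ y) (I : Finset ι) (i : ι) : mix x y I i ≤ y := by
  unfold mix
  split <;> simp [hxy]

theorem le_termOp_mix (hQ : IsMeetOrder Q 𝓗) {F : (ι → Q.carrier) → Q.carrier}
    (hF : IsTermOp Q ι F) {x y : Q.carrier} (hxy : x ≤ y) (I : Finset ι) : x ≤ F (mix x y I) := by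
  have := hQ.termOp_le hF (x := fun _ => x) (le_mix hxy I)
  rwa [hF.apply_const hQ.idem] at this

theorem termOp_mix_le (hQ : IsMeetOrder Q 𝓗) {F : (ι → Q.carrier) → Q.carrier}
    (hF : IsTermOp Q ι F) {x y : Q.carrier} (hxy : x ≤ y) (I : Finset ι) : F (mix x y I) ≤ y := by
  have := hQ.termOp_le hF (y := fun _ => y) (mix_le hxy I)
  rwa [hF.apply_const hQ.idem] at this

/-- Two disjoint sets cannot both belong to the family `{I | h (F (mix x y I))}`. -/
theorem not_disjoint (hQ : IsMeetOrder Q 𝓗) {F : (ι → Q.carrier) → Q.carrier}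
    (hF : IsTermOp Q ι F) {x y : Q.carrier} (hxy : x ≤ y) {h : Q.carrier → Prop} (hh : h ∈ 𝓗)
    (hx : ¬ h x) {I J : Finset ι} (hI : h (F (mix x y I))) (hJ : h (F (mix x y J))) :
    I ∩ J ≠ ∅ := by
  intro hIJ
  have := hQ.inter h hh ι F hF x y hxy I J hI hJ
  rw [hIJ, mix_empty, hF.apply_const hQ.idem] at this
  exact hx this

/-- If no binary term separates `x` from `y` in the sense of `exists_termOp₂`, then every term
operation depends on exactly one of its variables. -/
theorem exists_principal [Fintype ι] (hQ : IsMeetOrder Q 𝓗) {x y : Q.carrier} (hxy : x ≤ y)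
    {h : Q.carrier → Prop} (hh : h ∈ 𝓗) (hx : ¬ h x)
    (hbad : ∀ t, IsTermOp₂ Q t → h (t x y) ∨ h (t y x)) {F : (ι → Q.carrier) → Q.carrier}
    (hF : IsTermOp Q ι F) : ∃ i, h (F (mix x y {i})) := by
  classical
  have hy : h y := (hbad _ .snd).resolve_right hx
  let 𝓕 : Finset (Finset ι) := Finset.univ.filter fun I => h (F (mix x y I))
  have hU : h (F (mix x y (𝓕.inf id))) := by
    refine Finset.inf_induction (p := fun I => h (F (mix x y I))) ?_ ?_ ?_
    · have : mix x y (⊤ : Finset ι) = fun _ => y := by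
        funext i
        simp [mix]
      rw [this, hF.apply_const hQ.idem]
      exact hy
    · exact fun I hI J hJ => hQ.inter h hh ι F hF x y hxy I J hI hJ
    · exact fun I hI => (Finset.mem_filter.1 hI).2
  have hne : (𝓕.inf id).Nonempty := by
    rw [Finset.nonempty_iff_ne_empty]
    intro h0
    rw [h0, mix_empty, hF.apply_const hQ.idem] at hU
    exact hx hU
  obtain ⟨i, hi⟩ := hne
  have ht : IsTermOp₂ Q fun s w => F fun j => if j = i then w else s := by
    refine IsTermOp.gen hF (g := fun j (p : Q.carrier × Q.carrier) => if j = i then p.2 else p.1)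
      fun j => ?_
    by_cases hj : j = i
    · simp only [hj, if_true]
      exact IsTermOp₂.snd
    · simp only [hj, if_false]
      exact IsTermOp₂.fst
  rcases hbad _ ht with h1 | h1
  · refine ⟨i, ?_⟩
    convert h1 using 3 with j
    simp [mix]
  · exfalso
    have hc : h (F (mix x y {i}ᶜ)) := by
      convert h1 using 3 with j
      by_cases hj : j = i <;> simp [mix, hj]
    have hle : 𝓕.inf id ≤ {i}ᶜ :=
      Finset.inf_le (f := id) (Finset.mem_filter.2 ⟨Finset.mem_univ _, hc⟩)
    have := hle hi
    simp at this

/-- If there is no subalgebra with a set quotient then for `x ≤ y` and `¬ h x` some binary term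
takes values outside `h` both on `(x, y)` and on `(y, x)`. -/
theorem exists_termOp₂ (hQ : IsMeetOrder Q 𝓗) [Finite Q.carrier] (hset : ¬ HasSetQuot Q)
    {x y : Q.carrier} (hxy : x ≤ y) {h : Q.carrier → Prop} (hh : h ∈ 𝓗) (hx : ¬ h x) :
    ∃ t, IsTermOp₂ Q t ∧ ¬ h (t x y) ∧ ¬ h (t y x) := by
  by_contra! hcon
  let Bad : Q.carrier → Prop := fun y => ∀ t, IsTermOp₂ Q t → h (t x y) ∨ h (t y x)
  obtain ⟨y, ⟨hxy, hbad⟩, hmin⟩ : ∃ y, (x ≤ y ∧ Bad y) ∧ ∀ w, x ≤ w → Bad w → w ≤ y → w = y := by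
    obtain ⟨y, hy⟩ := (Set.toFinite {y | x ≤ y ∧ Bad y}).exists_minimal
      ⟨y, hxy, fun t ht => or_iff_not_imp_left.2 (hcon t ht)⟩
    exact ⟨y, hy.prop, fun w h1 h2 h3 => hy.eq_of_le ⟨h1, h2⟩ h3⟩
  have hy : h y := (hbad _ .snd).resolve_right hx
  have hE : ∀ t, IsTermOp₂ Q t → h (t x y) → t x y = y := by
    intro t₀ ht₀ he
    have hle : t₀ x y ≤ y := by
      have := hQ.termOp₂_le ht₀ hxy (le_refl y)
      rwa [hQ.termOp₂_self ht₀] at this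
    have hge : x ≤ t₀ x y := by
      have := hQ.termOp₂_le ht₀ (le_refl x) hxy
      rwa [hQ.termOp₂_self ht₀] at this
    refine hmin _ hge (fun t ht => ?_) hle
    have hF : IsTermOp Q (Fin 4) fun v => t (t₀ (v 0) (v 1)) (t₀ (v 2) (v 3)) :=
      ht.isTermOp (ht₀.isTermOp (.var 0) (.var 1)) (ht₀.isTermOp (.var 2) (.var 3))
    obtain ⟨i, hi⟩ := hQ.exists_principal hxy hh hx hbad hF
    have h13 : h (t (t₀ (mix x y {1, 3} (0 : Fin 4)) (mix x y {1, 3} (1 : Fin 4)))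
        (t₀ (mix x y {1, 3} (2 : Fin 4)) (mix x y {1, 3} (3 : Fin 4)))) := by
      simp [mix, hQ.termOp₂_self ht, he]
    have hd := hQ.not_disjoint hF hxy hh hx hi h13
    fin_cases i
    · exact absurd (by decide) hd
    · right
      simpa [mix, hQ.termOp₂_self ht₀] using hi
    · exact absurd (by decide) hd
    · left
      simpa [mix, hQ.termOp₂_self ht₀] using hi
  have hflip : ∀ {t}, IsTermOp₂ Q t → IsTermOp₂ Q fun a b => t b a := fun ht =>
    ht.gen IsTermOp₂.snd IsTermOp₂.fst
  refine hset ⟨{w | ∃ t, IsTermOp₂ Q t ∧ t x y = w}, ?_, fun w => w = y,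
    ⟨y, ⟨_, .snd, rfl⟩, rfl⟩, ⟨x, ⟨_, .fst, rfl⟩, fun hxy => hx (hxy ▸ hy)⟩, fun f => ?_⟩
  · intro f e he
    choose t ht hte using he
    exact ⟨fun a b => Q.interp f fun j => t j a b, Gen.app f _ ht, by simp only [hte]⟩
  · have hF := isTermOp_interp Q f
    obtain ⟨i, hi⟩ := hQ.exists_principal hxy hh hx hbad hF
    refine ⟨i, fun e he => ?_⟩
    choose t ht hte using he
    have hxe : ∀ j, x ≤ e j := fun j => by
      have := hQ.termOp₂_le (ht j) (le_refl x) hxy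
      rwa [hQ.termOp₂_self (ht j), hte] at this
    have hey : ∀ j, e j ≤ y := fun j => by
      have := hQ.termOp₂_le (ht j) hxy (le_refl y)
      rwa [hQ.termOp₂_self (ht j), hte] at this
    constructor
    · intro hfe
      by_contra hne
      have h1 : h (t i y x) := by
        refine (hbad _ (ht i)).resolve_left fun h1 => hne ?_
        rw [← hte i]
        exact hE _ (ht i) h1
      have h2 : t i y x = y := by
        by_contra h3
        have hle : t i y x ≤ y := by
          have := hQ.termOp₂_le (ht i) (le_refl y) hxy
          rwa [hQ.termOp₂_self (ht i)] at this
        exact h3 (hE _ (hflip (ht i)) h1)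
      have hG : IsTermOp Q (Fin 3) fun v =>
          Q.interp f fun j => if j = i then t i (v 0) (v 1) else v 2 := by
        refine IsTermOp.gen hF (g := fun j (v : Fin 3 → Q.carrier) =>
          if j = i then t i (v 0) (v 1) else v 2) fun j => ?_
        by_cases hj : j = i
        · simp only [hj, if_true]
          exact (ht i).isTermOp (.var 0) (.var 1)
        · simp only [hj, if_false]
          exact IsTermOp.var 2
      refine hQ.not_disjoint hG hxy hh hx (I := {1, 2}) (J := {0}) ?_ ?_ (by decide)
      · refine hQ.mono h hh _ _ (hQ.interp_le f e _ fun j => ?_) (hfe ▸ hy)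
        by_cases hj : j = i
        · subst hj
          simp [mix, hte]
        · simpa [mix, hj] using hey j
      · convert hi using 3 with j
        by_cases hj : j = i <;> simp [mix, hj, h2]
    · intro hei
      have h1 : h (Q.interp f e) := by
        refine hQ.mono h hh _ _ (hQ.interp_le f _ e fun j => ?_) hi
        by_cases hj : j = i
        · subst hj
          simp [mix, hei]
        · simpa [mix, hj] using hxe j
      have := hE (fun a b => Q.interp f fun j => t j a b) (Gen.app f _ ht)
      simp only [hte] at this
      exact this h1

end IsMeetOrder

end UAlgebra

/-- Sets of size at least `2 m`, `m` being their number, can be two-coloured so that none of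
them is monochromatic. -/
theorem exists_two_coloring {τ ι : Type} [DecidableEq τ] [DecidableEq ι] (I : τ → Finset ι)
    (k : ℕ) (𝒯 : Finset τ) (hk : 2 * 𝒯.card ≤ k) (hI : ∀ t ∈ 𝒯, k ≤ (I t).card) :
    ∃ P : Finset ι, ∀ t ∈ 𝒯, (∃ i ∈ I t, i ∈ P) ∧ ∃ i ∈ I t, i ∉ P := by
  suffices h : ∃ P N : Finset ι, Disjoint P N ∧ P.card ≤ 𝒯.card ∧ N.card ≤ 𝒯.card ∧
      ∀ t ∈ 𝒯, (∃ i ∈ I t, i ∈ P) ∧ ∃ i ∈ I t, i ∈ N by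
    obtain ⟨P, N, hd, -, -, h⟩ := h
    refine ⟨P, fun t ht => ⟨(h t ht).1, ?_⟩⟩
    obtain ⟨i, h1, h2⟩ := (h t ht).2
    exact ⟨i, h1, fun h3 => Finset.disjoint_left.1 hd h3 h2⟩
  induction 𝒯 using Finset.induction_on with
  | empty => exact ⟨∅, ∅, by simp⟩
  | insert t 𝒯 ht ih =>
    rw [Finset.card_insert_of_notMem ht] at hk ⊢
    obtain ⟨P, N, hd, hP, hN, h⟩ := ih (by omega) fun t ht => hI t (Finset.mem_insert_of_mem ht)
    have hcard : 1 < (I t \ (P ∪ N)).card := by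
      have h1 := Finset.le_card_sdiff (P ∪ N) (I t)
      have h2 := Finset.card_union_le P N
      have h3 := hI t (Finset.mem_insert_self _ _)
      omega
    obtain ⟨a, ha, b, hb, hab⟩ := Finset.one_lt_card.1 hcard
    simp only [Finset.mem_sdiff, Finset.mem_union, not_or] at ha hb
    refine ⟨insert a P, insert b N, ?_, (Finset.card_insert_le _ _).trans (by omega),
      (Finset.card_insert_le _ _).trans (by omega), ?_⟩
    · simp only [Finset.disjoint_insert_left, Finset.disjoint_insert_right, Finset.mem_insert,
        not_or]
      grind
    · intro s hs
      rcases Finset.mem_insert.1 hs with rfl | hs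
      · exact ⟨⟨a, ha.1, Finset.mem_insert_self _ _⟩, b, hb.1, Finset.mem_insert_self _ _⟩
      · obtain ⟨⟨i, h1, h2⟩, j, h3, h4⟩ := h s hs
        exact ⟨⟨i, h1, Finset.mem_insert_of_mem h2⟩, j, h3, Finset.mem_insert_of_mem h4⟩

namespace UAlgebra

variable {σ : Signature}

/-- Star composition of term operations. -/
theorem IsTermOp.star {A : UAlgebra σ} {ι κ : Type} {F : (ι → A.carrier) → A.carrier}
    {G : (κ → A.carrier) → A.carrier} (hF : IsTermOp A ι F) (hG : IsTermOp A κ G) :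
    IsTermOp A (ι × κ) fun v => F fun j => G fun l => v (j, l) :=
  IsTermOp.gen hF (g := fun j (v : ι × κ → A.carrier) => G fun l => v (j, l)) fun j =>
    IsTermOp.gen hG (g := fun l (v : ι × κ → A.carrier) => v (j, l)) fun l => IsTermOp.var (j, l)

namespace IsMeetOrder

variable {Q : UAlgebra σ} [PartialOrder Q.carrier] {𝓗 : Set (Q.carrier → Prop)}

/-- The single-variable property for finitely many triples `(x, y, h)`. -/
theorem exists_termOp_finset (hQ : IsMeetOrder Q 𝓗) [Finite Q.carrier] (hset : ¬ HasSetQuot Q)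
    (𝒯 : Finset (Q.carrier × Q.carrier × (Q.carrier → Prop)))
    (h𝒯 : ∀ x y h, (x, y, h) ∈ 𝒯 → x ≤ y ∧ h ∈ 𝓗 ∧ ¬ h x) :
    ∃ (ι : Type) (_ : Fintype ι) (_ : DecidableEq ι) (F : (ι → Q.carrier) → Q.carrier),
      IsTermOp Q ι F ∧ ∀ x y h, (x, y, h) ∈ 𝒯 → ∀ i, ¬ h (F (mix x y {i})) := by
  classical
  induction 𝒯 using Finset.induction_on with
  | empty => exact ⟨Unit, inferInstance, inferInstance, _, .var (), by simp⟩
  | insert τ 𝒯 _ ih =>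
    obtain ⟨ι, _, _, F, hF, hgood⟩ :=
      ih fun x y h hm => h𝒯 x y h (Finset.mem_insert_of_mem hm)
    obtain ⟨x, y, h⟩ := τ
    obtain ⟨hxy, hh, hx⟩ := h𝒯 x y h (Finset.mem_insert_self _ _)
    by_cases hall : ∀ i, ¬ h (F (mix x y {i}))
    · refine ⟨ι, inferInstance, inferInstance, F, hF, fun x' y' h' hm => ?_⟩
      rcases Finset.mem_insert.1 hm with heq | hm
      · cases heq
        exact hall
      · exact hgood x' y' h' hm
    push Not at hall
    obtain ⟨i, hi⟩ := hall
    have huniq : ∀ j, h (F (mix x y {j})) → j = i := by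
      intro j hj
      by_contra hne
      refine hQ.not_disjoint hF hxy hh hx hj hi ?_
      rw [Finset.singleton_inter_of_notMem (by simpa using hne)]
    have hm : IsPol Q fun w => F (mix x w {i}) := by
      refine hF.isPol (m := fun j w => mix x w {i} j) fun j => ?_
      by_cases hj : j = i
      · simpa [mix, hj] using IsPol.id
      · simpa [mix, hj] using IsPol.const x
    have hconst : F (mix x x {i}) = x := by
      rw [show mix x x {i} = fun _ => x by funext j; simp [mix]]
      exact hF.apply_const hQ.idem x
    obtain ⟨t, ht, ht1, ht2⟩ := hQ.exists_termOp₂ hset hxy (hQ.comp h hh _ hm)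
      (by simpa only [hconst] using hx)
    have htop : IsTermOp Q (Fin 2) fun v => t (v 0) (v 1) := ht.isTermOp (.var 0) (.var 1)
    have hmix : ∀ (x y : Q.carrier) (p : ι × Fin 2) (j : ι),
        (t (mix x y {p} (j, 0)) (mix x y {p} (j, 1))) =
          mix x (t (mix x y {p.2} 0) (mix x y {p.2} 1)) {p.1} j := by
      intro x y p j
      by_cases hj : j = p.1
      · subst hj
        simp [mix, Prod.ext_iff]
      · simp [mix, Prod.ext_iff, hj, hQ.termOp₂_self ht]
    refine ⟨ι × Fin 2, inferInstance, inferInstance, _, hF.star htop, fun x' y' h' hm' p => ?_⟩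
    simp only [hmix]
    by_cases hm2 : (x', y', h') ∈ 𝒯
    · obtain ⟨hxy', hh', hx'⟩ := h𝒯 x' y' h' hm'
      refine fun hc => hgood x' y' h' hm2 p.1 (hQ.mono h' hh' _ _ (hQ.termOp_le hF fun j => ?_) hc)
      unfold mix
      split
      · exact hQ.termOp_mix_le htop hxy' {p.2}
      · exact le_rfl
    · have heq := (Finset.mem_insert.1 hm').resolve_right hm2
      cases heq
      intro hc
      by_cases hp : p.1 = i
      · rw [hp] at hc
        have hfun : ∀ w, mix x w {i} = fun j => if j = i then w else x := fun w => by
          funext j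
          simp [mix]
        generalize p.2 = q at hc
        fin_cases q
        · exact ht2 (by simpa [mix, hfun] using hc)
        · exact ht1 (by simpa [mix, hfun] using hc)
      · refine hp (huniq _ (hQ.mono h hh _ _ (hQ.termOp_le hF fun j => ?_) hc))
        unfold mix
        split
        · exact hQ.termOp_mix_le htop hxy {p.2}
        · exact le_rfl

/-- The value of a term operation is determined by the up-sets in `𝓗`. -/
theorem eq_of_forall_not (hQ : IsMeetOrder Q 𝓗) {x w : Q.carrier} (hxw : x ≤ w)
    (h : ∀ h ∈ 𝓗, ¬ h x → ¬ h w) : w = x := by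
  by_contra hne
  obtain ⟨k, hk, hs⟩ := hQ.sep w x hne
  by_cases hx : k x
  · exact hs ⟨fun _ => hx, hQ.mono k hk _ _ hxw⟩
  · exact hs ⟨fun hw => absurd hw (h k hk hx), fun hx' => absurd hx' hx⟩

theorem exists_good_one (hQ : IsMeetOrder Q 𝓗) [Finite Q.carrier] (hset : ¬ HasSetQuot Q) :
    ∃ (ι : Type) (_ : Fintype ι) (_ : DecidableEq ι) (F : (ι → Q.carrier) → Q.carrier),
      IsTermOp Q ι F ∧ ∀ x y, x ≤ y → ∀ i, F (mix x y {i}) = x := by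
  classical
  have hfin : Finite (Q.carrier × Q.carrier × (Q.carrier → Prop)) := inferInstance
  have := Fintype.ofFinite (Q.carrier × Q.carrier × (Q.carrier → Prop))
  obtain ⟨ι, _, _, F, hF, hgood⟩ := hQ.exists_termOp_finset hset
    (Finset.univ.filter fun τ => τ.1 ≤ τ.2.1 ∧ τ.2.2 ∈ 𝓗 ∧ ¬ τ.2.2 τ.1)
    (fun x y h hm => by simpa using hm)
  refine ⟨ι, inferInstance, inferInstance, F, hF, fun x y hxy i => ?_⟩
  refine hQ.eq_of_forall_not (hQ.le_termOp_mix hF hxy _) fun h hh hx => ?_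
  exact hgood x y h (by simp [hxy, hh, hx]) i

theorem exists_good (hQ : IsMeetOrder Q 𝓗) [Finite Q.carrier] (hset : ¬ HasSetQuot Q) (k : ℕ) :
    ∃ (ι : Type) (_ : Fintype ι) (_ : DecidableEq ι) (F : (ι → Q.carrier) → Q.carrier),
      IsTermOp Q ι F ∧ ∀ x y, x ≤ y → ∀ I : Finset ι, I.card ≤ k → F (mix x y I) = x := by
  classical
  obtain ⟨κ, _, _, G, hG, hG1⟩ := hQ.exists_good_one hset
  induction k with
  | zero =>
    refine ⟨κ, inferInstance, inferInstance, G, hG, fun x y _ I hI => ?_⟩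
    rw [Finset.card_eq_zero.1 (Nat.le_zero.1 hI), mix_empty, hG.apply_const hQ.idem]
  | succ k ih =>
    obtain ⟨ι, _, _, F, hF, hFk⟩ := ih
    refine ⟨κ × ι, inferInstance, inferInstance, _, hG.star hF, fun x y hxy I hI => ?_⟩
    let fib : κ → Finset ι := fun j => Finset.univ.filter fun l => (j, l) ∈ I
    have hmix : ∀ j, (fun l => mix x y I (j, l)) = mix x y (fib j) := by
      intro j
      funext l
      simp [mix, fib]
    simp only [hmix]
    by_cases hall : ∀ j, (fib j).card ≤ k
    · have : (fun j => F (mix x y (fib j))) = fun _ => x :=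
        funext fun j => hFk x y hxy _ (hall j)
      rw [this, hG.apply_const hQ.idem]
    push Not at hall
    obtain ⟨j, hj⟩ := hall
    have hothers : ∀ j', j' ≠ j → fib j' = ∅ := by
      intro j' hne
      by_contra hne'
      obtain ⟨l, hl⟩ := Finset.nonempty_iff_ne_empty.2 hne'
      have hsub : insert (j', l) ((fib j).image fun l => (j, l)) ⊆ I := by
        intro p hp
        rcases Finset.mem_insert.1 hp with rfl | hp
        · exact (Finset.mem_filter.1 hl).2
        · obtain ⟨l', hl', rfl⟩ := Finset.mem_image.1 hp
          exact (Finset.mem_filter.1 hl').2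
      have hc := Finset.card_le_card hsub
      rw [Finset.card_insert_of_notMem (by simp [Ne.symm hne]),
        Finset.card_image_of_injective _ (Prod.mk_right_injective j)] at hc
      omega
    have hval : (fun j => F (mix x y (fib j))) = mix x (F (mix x y (fib j))) {j} := by
      funext j'
      by_cases hne : j' = j
      · simp [mix, hne]
      · simp only [hothers j' hne, mix_empty, hF.apply_const hQ.idem]
        simp [mix, hne]
    rw [hval]
    exact hG1 _ _ (hQ.le_termOp_mix hF hxy _) j

/-- There is a binary term which acts as the meet operation on comparable pairs. -/
theorem exists_meet_term (hQ : IsMeetOrder Q 𝓗) [Finite Q.carrier] (hset : ¬ HasSetQuot Q) :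
    ∃ s, IsTermOp₂ Q s ∧ ∀ x y, x ≤ y → s x y = x ∧ s y x = x := by
  classical
  have hfin : Finite (Q.carrier × Q.carrier × (Q.carrier → Prop)) := inferInstance
  have := Fintype.ofFinite (Q.carrier × Q.carrier × (Q.carrier → Prop))
  obtain ⟨ι, _, _, F, hF, hgood⟩ := hQ.exists_good hset
    (2 * Fintype.card (Q.carrier × Q.carrier × (Q.carrier → Prop)))
  let Fam : Q.carrier × Q.carrier × (Q.carrier → Prop) → Finset ι → Prop :=
    fun τ I => τ.2.2 (F (mix τ.1 τ.2.1 I))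
  let Ess : Q.carrier × Q.carrier × (Q.carrier → Prop) → Finset ι :=
    fun τ => Finset.univ.filter fun i => ¬ Fam τ {i}ᶜ
  let 𝒯 : Finset (Q.carrier × Q.carrier × (Q.carrier → Prop)) :=
    Finset.univ.filter fun τ => τ.1 ≤ τ.2.1 ∧ τ.2.2 ∈ 𝓗 ∧ ¬ τ.2.2 τ.1 ∧ τ.2.2 τ.2.1
  have hEss : ∀ τ ∈ 𝒯, 2 * Fintype.card (Q.carrier × Q.carrier × (Q.carrier → Prop)) ≤
      (Ess τ).card := by
    rintro ⟨x, y, h⟩ hm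
    obtain ⟨hxy, hh, hx, hy⟩ : x ≤ y ∧ h ∈ 𝓗 ∧ ¬ h x ∧ h y := by simpa [𝒯] using hm
    have hmem : h (F (mix x y (Ess (x, y, h)))) := by
      have hrw : Ess (x, y, h) =
          (Finset.univ.filter fun i => Fam (x, y, h) {i}ᶜ).inf fun i => {i}ᶜ := by
        ext i
        simp only [Ess, Finset.mem_filter, Finset.mem_univ, true_and, Finset.mem_inf,
          Finset.mem_compl, Finset.mem_singleton]
        constructor
        · rintro h1 j h2 rfl
          exact h1 h2
        · exact fun h1 h2 => h1 i h2 rfl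
      rw [hrw]
      refine Finset.inf_induction (p := fun I => h (F (mix x y I))) ?_ ?_ ?_
      · have : mix x y (⊤ : Finset ι) = fun _ => y := by
          funext i
          simp [mix]
        rw [this, hF.apply_const hQ.idem]
        exact hy
      · exact fun I hI J hJ => hQ.inter h hh ι F hF x y hxy I J hI hJ
      · exact fun i hi => (Finset.mem_filter.1 hi).2
    by_contra hlt
    rw [hgood x y hxy _ (by omega)] at hmem
    exact hx hmem
  obtain ⟨P, hP⟩ := exists_two_coloring Ess _ 𝒯
    (Nat.mul_le_mul_left 2 (Finset.card_le_univ 𝒯)) hEss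
  have hsub : ∀ x y h, (x, y, h) ∈ 𝒯 → ∀ I, h (F (mix x y I)) → Ess (x, y, h) ⊆ I := by
    intro x y h hm I hI i hi
    by_contra hiI
    obtain ⟨hxy, hh, -, -⟩ : x ≤ y ∧ h ∈ 𝓗 ∧ ¬ h x ∧ h y := by simpa [𝒯] using hm
    refine (Finset.mem_filter.1 hi).2 (hQ.mono h hh _ _ (hQ.termOp_le hF ?_) hI)
    refine mix_mono hxy fun j hj => ?_
    simp only [Finset.mem_compl, Finset.mem_singleton]
    rintro rfl
    exact hiI hj
  have key : ∀ x y, x ≤ y → ∀ I : Finset ι, (I = P ∨ I = Pᶜ) → F (mix x y I) = x := by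
    intro x y hxy I hIP
    refine hQ.eq_of_forall_not (hQ.le_termOp_mix hF hxy _) fun h hh hx hI => ?_
    have hm : (x, y, h) ∈ 𝒯 := by
      simpa [𝒯, hxy, hh, hx] using hQ.mono h hh _ _ (hQ.termOp_mix_le hF hxy I) hI
    have hs := hsub x y h hm I hI
    obtain ⟨⟨i, hi, hiP⟩, j, hj, hjP⟩ := hP _ hm
    rcases hIP with rfl | rfl
    · exact hjP (hs hj)
    · exact Finset.mem_compl.1 (hs hi) hiP
  refine ⟨fun a b => F fun i => if i ∈ P then b else a,
    IsTermOp.gen hF (g := fun i (p : Q.carrier × Q.carrier) => if i ∈ P then p.2 else p.1)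
      fun i => ?_, fun x y hxy => ⟨key x y hxy P (Or.inl rfl), ?_⟩⟩
  · by_cases hi : i ∈ P
    · simp only [hi, if_true]
      exact IsTermOp₂.snd
    · simp only [hi, if_false]
      exact IsTermOp₂.fst
  · convert key x y hxy Pᶜ (Or.inr rfl) using 2
    funext i
    by_cases hi : i ∈ P <;> simp [mix, hi]

/-- A two-generated algebra with a meet order and without set quotients has a term acting as a
semilattice operation on the generators. -/
theorem exists_semilattice (hQ : IsMeetOrder Q 𝓗) [Finite Q.carrier] (hset : ¬ HasSetQuot Q)
    {a b : Q.carrier} (hgen : ∀ q, ∃ w, IsTermOp₂ Q w ∧ w a b = q) :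
    ∃ t : Term σ 2, IsSemilatticeOn (fun x y => t.eval Q ![x, y]) {a, b} := by
  obtain ⟨s, hs, hmeet⟩ := hQ.exists_meet_term hset
  obtain ⟨c, hca, hcb⟩ : ∃ c, c ≤ a ∧ c ≤ b := by
    refine hQ.conn (fun w => ∃ c, c ≤ a ∧ c ≤ w) (fun x y hxy => ⟨?_, ?_⟩) a b ⟨a, le_rfl, le_rfl⟩
    · rintro ⟨c, h1, h2⟩
      exact ⟨c, h1, h2.trans hxy⟩
    · rintro ⟨c, h1, h2⟩
      have e1 : s c x ≤ c := by
        have := hQ.termOp₂_le hs (le_refl c) hxy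
        rwa [(hmeet c y h2).1] at this
      have e2 : s c x ≤ x := by
        have := hQ.termOp₂_le hs h2 (le_refl x)
        rwa [(hmeet x y hxy).2] at this
      exact ⟨s c x, e1.trans h1, e2⟩
  have hbot : ∀ q, c ≤ q := by
    intro q
    obtain ⟨w, hw, rfl⟩ := hgen q
    have := hQ.termOp₂_le hw hca hcb
    rwa [hQ.termOp₂_self hw] at this
  obtain ⟨w, hw, hwc⟩ := hgen c
  have hk : IsTermOp₂ Q fun x y => s (w x y) (w y x) :=
    hs.gen hw (hw.gen IsTermOp₂.snd IsTermOp₂.fst)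
  obtain ⟨t, ht⟩ := IsTermOp₂.exists_term (F := fun x y => s (s x y) (s (w x y) (w y x))) (hs.gen hs hk)
  have hsc : ∀ x, s x c = c := fun x => (hmeet c x (hbot x)).2
  have hcs : ∀ x, s c x = c := fun x => (hmeet c x (hbot x)).1
  have eab : t.eval Q ![a, b] = c := by rw [ht, hwc, hcs, hsc]
  have eba : t.eval Q ![b, a] = c := by rw [ht, hwc, hsc, hsc]
  have exc : ∀ x, t.eval Q ![x, c] = c := fun x => by rw [ht, hsc, hcs]
  have ecx : ∀ x, t.eval Q ![c, x] = c := fun x => by rw [ht, hcs, hcs]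
  have exx : ∀ x, t.eval Q ![x, x] = x := fun x => hQ.idem.eval_two t x
  refine ⟨t, fun x _ => exx x, ?_, ?_⟩
  · rintro x (rfl | rfl) y (rfl | rfl)
    exacts [rfl, eab.trans eba.symm, eba.trans eab.symm, rfl]
  · rintro x (rfl | rfl) y (rfl | rfl) z (rfl | rfl) <;>
      simp only [exx, eab, eba, exc, ecx]

end IsMeetOrder

end UAlgebra

namespace UAlgebra

variable {σ : Signature} {Q : UAlgebra σ} {z o : Q.carrier} {e : Q.carrier → Q.carrier}
  {M : Q.carrier → Q.carrier → Q.carrier}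

/-- Without a join polynomial, the polynomial images of `(z, o)` generate a partial order. -/
@[reducible]
def HasMeet.partialOrder (h : HasMeet Q z o e M) (hQ : Q.IsSimple) (hJ : NoJoin Q z o) :
    PartialOrder Q.carrier where
  le := polLE Q z o
  le_refl _ := .refl
  le_trans _ _ _ := .trans
  le_antisymm _ _ h₁ h₂ := h.antisymm hQ hJ h₁ h₂

theorem HasMeet.isMeetOrder (h : HasMeet Q z o e M) (hQ : Q.IsSimple) (hJ : NoJoin Q z o)
    (hid : Q.Idempotent) :
    letI := h.partialOrder hQ hJ
    IsMeetOrder Q {H | ∃ k, IsPol Q k ∧ (∀ x, k x = z ∨ k x = o) ∧ H = fun w => k w = o} := by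
  let := h.partialOrder hQ hJ
  refine ⟨hid, ?_, ?_, ?_, ?_, ?_, ?_⟩
  · exact interp_rel (R := polLE Q z o) (fun _ => .refl) (fun _ _ _ => .trans) polLE_isPol
  · rintro _ ⟨k, hk, hv, rfl⟩ x y hxy hx
    exact h.mono_pol hJ hk hv hxy hx
  · rintro _ ⟨k, hk, hv, rfl⟩ ι _ F hF x y hxy I J hI hJ'
    let H : Q.carrier → Q.carrier → Q.carrier := fun s t =>
      k (F fun i => if i ∈ I then (if i ∈ J then y else s) else if i ∈ J then t else x)
    have hH : IsPol₂ Q H := by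
      refine hk.comp₂ (hF.isPol₂ (m := fun i s t =>
        if i ∈ I then (if i ∈ J then y else s) else if i ∈ J then t else x) fun i => ?_)
      by_cases h1 : i ∈ I <;> by_cases h2 : i ∈ J <;> simp only [h1, h2, if_true, if_false]
      exacts [.const y, .fst, .snd, .const x]
    have e1 : H y x = k (F (mix x y I)) := by
      refine congrArg (fun v => k (F v)) (funext fun i => ?_)
      by_cases h1 : i ∈ I <;> by_cases h2 : i ∈ J <;> simp [mix, h1, h2]
    have e2 : H x y = k (F (mix x y J)) := by
      refine congrArg (fun v => k (F v)) (funext fun i => ?_)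
      by_cases h1 : i ∈ I <;> by_cases h2 : i ∈ J <;> simp [mix, h1, h2]
    have e3 : H x x = k (F (mix x y (I ∩ J))) := by
      refine congrArg (fun v => k (F v)) (funext fun i => ?_)
      by_cases h1 : i ∈ I <;> by_cases h2 : i ∈ J <;> simp [mix, h1, h2]
    exact e3.symm.trans
      (h.grid hJ hH (fun _ _ => hv _) hxy hxy (e1.trans hI) (e2.trans hJ'))
  · rintro _ ⟨k, hk, hv, rfl⟩ m hm
    exact ⟨fun w => k (m w), hk.comp hm, fun x => hv _, rfl⟩
  · intro x y hne
    obtain ⟨k, hk, hke⟩ := hQ.separate h.nonconst hne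
    refine ⟨_, ⟨fun w => e (k w), h.pol.comp hk, fun _ => h.mem _, rfl⟩, fun hiff => hke ?_⟩
    rcases h.mem (k x) with h1 | h1 <;> rcases h.mem (k y) with h2 | h2
    · exact h1.trans h2.symm
    · exact (hiff.2 h2).trans h2.symm
    · exact h1.trans (hiff.1 h1).symm
    · exact h1.trans h2.symm
  · intro P hP x y hx
    have := hQ.connected h.ne P (fun m hm => propext (hP _ _ (.single ⟨m, hm, rfl, rfl⟩))) x y
    exact this ▸ hx

/-- A simple two-generated quotient with a majority term on its generators, but without
semilattice terms on them and without set quotients, is prime with respect to intersections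
of congruences. -/
theorem prime_of_majority {B : UAlgebra σ} [Finite B.carrier] [Finite Q.carrier]
    (hQ : Q.IsSimple) (hid : Q.Idempotent) {φ : B.carrier → Q.carrier} (hφ : IsHom B Q φ)
    (hs : Function.Surjective φ) (hset : ¬ HasSetQuot Q) {a b : Q.carrier} (hab : a ≠ b)
    (hgen : ∀ q, ∃ w, IsTermOp₂ Q w ∧ w a b = q) {g : Term σ 3}
    (hg : IsMajorityOn (fun x y z => g.eval Q ![x, y, z]) {a, b})
    (hsl : ¬ ∃ t : Term σ 2, IsSemilatticeOn (fun x y => t.eval Q ![x, y]) {a, b})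
    {η₁ η₂ : Congruence B} (hinf : ∀ x y, η₁.rel x y → η₂.rel x y → φ x = φ y) :
    (∀ x y, η₁.rel x y → φ x = φ y) ∨ ∀ x y, η₂.rel x y → φ x = φ y := by
  by_contra! hc
  obtain ⟨h₁, h₂⟩ := hc
  obtain ⟨z, o, e, M, h⟩ := exists_hasMeet hQ hab hg
  have hJ : NoJoin Q z o := fun J hJ => h.no_join hQ hφ hs hinf h₁ h₂ hJ
  let := h.partialOrder hQ hJ
  exact hsl ((h.isMeetOrder hQ hJ hid).exists_semilattice hset hgen)

end UAlgebra

namespace UAlgebra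

variable {σ : Signature}

section SetQuotients

theorem HasSetQuot.of_surjective {B Q : UAlgebra σ} {φ : B.carrier → Q.carrier}
    (hφ : IsHom B Q φ) (hs : Function.Surjective φ) (h : HasSetQuot Q) : HasSetQuot B := by
  obtain ⟨S, hS, χ, ⟨x, hx, hχx⟩, ⟨y, hy, hχy⟩, h⟩ := h
  obtain ⟨x, rfl⟩ := hs x
  obtain ⟨y, rfl⟩ := hs y
  refine ⟨φ ⁻¹' S, fun f w hw => ?_, χ ∘ φ, ⟨x, hx, hχx⟩, ⟨y, hy, hχy⟩, fun f => ?_⟩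
  · rw [Set.mem_preimage, hφ f]
    exact hS f _ hw
  · obtain ⟨i, hi⟩ := h f
    refine ⟨i, fun w hw => ?_⟩
    rw [Function.comp_apply, hφ f]
    exact hi _ hw

theorem HasSetQuot.of_subalg {A : UAlgebra σ} {S : Set A.carrier} {hS : A.IsClosed S}
    (h : HasSetQuot (A.subalg S hS)) : HasSetQuot A := by
  obtain ⟨E, hE, χ, ⟨x, hx, hχx⟩, ⟨y, hy, hχy⟩, h⟩ := h
  refine ⟨{a | ∃ ha : a ∈ S, (⟨a, ha⟩ : (A.subalg S hS).carrier) ∈ E}, fun f w hw => ?_,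
    fun a => ∃ ha : a ∈ S, χ ⟨a, ha⟩, ⟨x.1, ⟨x.2, hx⟩, x.2, hχx⟩,
    ⟨y.1, ⟨y.2, hy⟩, fun ⟨_, hc⟩ => hχy hc⟩, fun f => ?_⟩
  · choose h1 h2 using hw
    exact ⟨hS f w h1, hE f (fun j => ⟨w j, h1 j⟩) h2⟩
  · obtain ⟨i, hi⟩ := h f
    refine ⟨i, fun w hw => ?_⟩
    choose h1 h2 using hw
    have := hi (fun j => ⟨w j, h1 j⟩) h2
    exact ⟨fun ⟨_, hc⟩ => ⟨h1 i, this.1 hc⟩, fun ⟨_, hc⟩ => ⟨hS f w h1, this.2 hc⟩⟩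

theorem IsSetAlgebra.hasSetQuot {Q : UAlgebra σ} (h : Q.IsSetAlgebra) {p q : Q.carrier}
    (hpq : p ≠ q) : HasSetQuot Q := by
  refine ⟨Set.univ, Q.isClosed_univ, (· = p), ⟨p, trivial, rfl⟩, ⟨q, trivial, hpq.symm⟩,
    fun f => ?_⟩
  obtain ⟨i, hi⟩ := h _ (.app f .var)
  exact ⟨i, fun x _ => by rw [← hi x]; rfl⟩

theorem OmitsType1.not_hasSetQuot {A : UAlgebra σ} (hA : A.Idempotent) (h : A.OmitsType1) :
    ¬ HasSetQuot A := by
  rintro ⟨S, hS, χ, ⟨u, hu, hχu⟩, ⟨v, hv, hχv⟩, hχ⟩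
  let a : (A.subalg S hS).carrier := ⟨u, hu⟩
  let b : (A.subalg S hS).carrier := ⟨v, hv⟩
  let θ : Congruence ((A.subalg S hS).Sg {a, b}) :=
    { rel := fun x y => χ x.1.1 ↔ χ y.1.1
      refl := fun _ => Iff.rfl
      symm := Iff.symm
      trans := Iff.trans
      compat := fun f x y hxy => by
        obtain ⟨i, hi⟩ := hχ f
        exact (hi _ fun j => (x j).1.2).trans ((hxy i).trans (hi _ fun j => (y j).1.2).symm) }
  have hab : ¬ θ.rel (sgA _ a b) (sgB _ a b) := fun hc => hχv (hc.1 hχu)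
  have hne : u ≠ v := fun hc => hχv (hc ▸ hχu)
  refine h S hS a b ⟨fun hc => hne (congrArg Subtype.val hc), θ,
    ⟨fun hf => hab (hf _ _), fun η hle hη x y hxy => ?_⟩, fun n t => ?_⟩
  · by_contra hne
    refine hη (Congruence.isFull_of_rel (hA.subalg hS) ?_)
    have key : ∀ x y, η.rel x y → χ x.1.1 → ¬ χ y.1.1 → η.rel (sgA _ a b) (sgB _ a b) :=
      fun x y hxy hx hy => η.trans (hle _ _ (iff_of_true hχu hx))
        (η.trans hxy (hle _ _ (iff_of_false hy hχv)))
    by_cases hx : χ x.1.1 <;> by_cases hy : χ y.1.1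
    · exact absurd (iff_of_true hx hy) hne
    · exact key x y hxy hx hy
    · exact key y x (η.symm hxy) hy hx
    · exact absurd (iff_of_false hx hy) hne
  · induction t with
    | var i => exact ⟨i, fun _ => rfl⟩
    | app f ts ih =>
      obtain ⟨j, hj⟩ := hχ f
      obtain ⟨i, hi⟩ := ih j
      refine ⟨i, fun x => ?_⟩
      rw [← hi x]
      choose y hy using fun l => quotMk_surjective θ ((ts l).eval (quot _ θ) x)
      simp only [Term.eval, ← hy]
      rw [← isHom_quotMk _ θ f y]
      exact quotMk_eq_iff.2 (hj _ fun l => (y l).1.2)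

/-- A function which is not constant on a closed subset `S` of a finite product depends on a
single coordinate on some closed subset of `S`, on which it is still not constant. -/
theorem exists_coordinate {ι : Type} [Finite ι] {A : ι → UAlgebra σ}
    (hfin : ∀ i, Finite (A i).carrier) (hid : ∀ i, (A i).Idempotent) {β : Type}
    (χ : (UAlgebra.pi A).carrier → β) {S : Set (UAlgebra.pi A).carrier}
    (hS : (UAlgebra.pi A).IsClosed S) (hχ : ∃ x ∈ S, ∃ y ∈ S, χ x ≠ χ y) :
    ∃ E ⊆ S, (UAlgebra.pi A).IsClosed E ∧ (∃ x ∈ E, ∃ y ∈ E, χ x ≠ χ y) ∧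
      ∃ i, ∀ x ∈ E, ∀ y ∈ E, x i = y i → χ x = χ y := by
  have : Finite (UAlgebra.pi A).carrier := inferInstanceAs (Finite (∀ i, (A i).carrier))
  let P : Set (UAlgebra.pi A).carrier → Prop := fun E =>
    E ⊆ S ∧ (UAlgebra.pi A).IsClosed E ∧ ∃ x ∈ E, ∃ y ∈ E, χ x ≠ χ y
  obtain ⟨E, hE⟩ := (Set.toFinite {E | P E}).exists_minimal ⟨S, subset_rfl, hS, hχ⟩
  obtain ⟨⟨hES, hEc, x, hx, y, hy, hxy⟩, hmin⟩ := hE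
  refine ⟨E, hES, hEc, ⟨x, hx, y, hy, hxy⟩, ?_⟩
  obtain ⟨i, hi⟩ : ∃ i, x i ≠ y i := by
    by_contra! hc
    exact hxy (congrArg χ (funext hc))
  refine ⟨i, fun u hu v hv huv => ?_⟩
  by_contra hne
  have hsub : {w ∈ E | w i = u i} ⊆ E := fun w hw => hw.1
  have hle := hmin (y := {w ∈ E | w i = u i}) ⟨hsub.trans hES, fun f w hw =>
    ⟨hEc f w fun j => (hw j).1, ?_⟩, u, ⟨hu, rfl⟩, v, ⟨hv, huv.symm⟩, hne⟩ hsub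
  · exact hi ((hle hx).2.trans (hle hy).2.symm)
  · change (A i).interp f (fun j => w j i) = u i
    simp only [fun j => (hw j).2, hid i f]

theorem HasSetQuot.exists_of_pi {ι : Type} [Finite ι] {A : ι → UAlgebra σ}
    (hfin : ∀ i, Finite (A i).carrier) (hid : ∀ i, (A i).Idempotent)
    (h : HasSetQuot (UAlgebra.pi A)) : ∃ i, HasSetQuot (A i) := by
  obtain ⟨S, hS, χ, ⟨x, hx, hχx⟩, ⟨y, hy, hχy⟩, h⟩ := h
  obtain ⟨E, hES, hE, ⟨x, hx, y, hy, hxy⟩, i, hi⟩ := exists_coordinate hfin hid χ hS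
    ⟨x, hx, y, hy, fun hc => hχy (hc ▸ hχx)⟩
  refine ⟨i, (fun w => w i) '' E, fun f w hw => ?_, fun a => ∃ w ∈ E, w i = a ∧ χ w, ?_⟩
  · choose v hv hvw using hw
    exact ⟨_, hE f v hv, congrArg ((A i).interp f) (funext hvw)⟩
  have key : ∀ w ∈ E, ((∃ v ∈ E, v i = w i ∧ χ v) ↔ χ w) := fun w hw =>
    ⟨fun ⟨v, hv, hvw, hχv⟩ => hi v hv w hw hvw ▸ hχv, fun hχw => ⟨w, hw, rfl, hχw⟩⟩
  have hne : ¬ (χ x ↔ χ y) := fun hc => hxy (propext hc)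
  have hmem : ∀ w ∈ E, w i ∈ (fun w : (UAlgebra.pi A).carrier => w i) '' E :=
    fun w hw => ⟨w, hw, rfl⟩
  refine ⟨?_, ?_, fun f => ?_⟩
  · by_cases hχ : χ x
    · exact ⟨x i, hmem x hx, (key x hx).2 hχ⟩
    · exact ⟨y i, hmem y hy, (key y hy).2 (by tauto)⟩
  · by_cases hχ : χ x
    · exact ⟨y i, hmem y hy, fun hc => hne (iff_of_true hχ ((key y hy).1 hc))⟩
    · exact ⟨x i, hmem x hx, fun hc => hχ ((key x hx).1 hc)⟩
  · obtain ⟨j, hj⟩ := h f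
    refine ⟨j, fun w hw => ?_⟩
    choose v hv hvw using hw
    obtain rfl : (fun l => v l i) = w := funext hvw
    exact (key _ (hE f v hv)).trans ((hj v fun l => hES (hv l)).trans (key _ (hv j)).symm)

end SetQuotients

section Affine

theorem IsAffineAlgebra.not_isSemilatticeOn {Q : UAlgebra σ} (h : Q.IsAffineAlgebra)
    {p q : Q.carrier} (hpq : p ≠ q) (t : Term σ 2) :
    ¬ IsSemilatticeOn (fun x y => t.eval Q ![x, y]) {p, q} := by
  rintro ⟨-, hcomm, hassoc⟩
  obtain ⟨R, _, _, _, _, hterm, -⟩ := h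
  obtain ⟨c, hc, ht⟩ := (hterm 2 (t.eval Q)).1 ⟨t, fun _ => rfl⟩
  have e1 := hcomm p (by simp) q (by simp)
  have e2 := hassoc p (by simp) q (by simp) q (by simp)
  simp only [ht, Fin.sum_univ_two, Matrix.cons_val_zero, Matrix.cons_val_one] at e1 e2 hc
  rw [eq_sub_of_add_eq' hc] at e1 e2
  refine hpq (sub_eq_zero.1 ?_)
  have h1 : c 0 • (p - q) + c 0 • (p - q) = p - q := by
    simp only [sub_smul, one_smul, smul_sub] at e1 ⊢
    rw [← sub_eq_zero] at e1 ⊢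
    rw [← e1]
    abel
  have h2 : c 0 • c 0 • (p - q) = c 0 • (p - q) := by
    simp only [sub_smul, one_smul, smul_sub, smul_add] at e2 ⊢
    rw [← sub_eq_zero] at e2
    rw [eq_comm, ← sub_eq_zero]
    rw [← e2]
    abel
  have h3 : c 0 • (p - q) = 0 := by
    have := congrArg (c 0 • ·) h1
    simp only [smul_add, h2] at this
    simpa using this
  rw [← h1, h3, add_zero]

theorem IsAffineAlgebra.not_isMajorityOn {Q : UAlgebra σ} (h : Q.IsAffineAlgebra)
    {p q : Q.carrier} (hpq : p ≠ q) (t : Term σ 3) :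
    ¬ IsMajorityOn (fun x y z => t.eval Q ![x, y, z]) {p, q} := by
  intro hm
  obtain ⟨h1, h2, h3⟩ := hm p (by simp) q (by simp)
  obtain ⟨R, _, _, _, _, hterm, -⟩ := h
  obtain ⟨c, hc, ht⟩ := (hterm 3 (t.eval Q)).1 ⟨t, fun _ => rfl⟩
  simp only [ht, Fin.sum_univ_three, Matrix.cons_val_zero, Matrix.cons_val_one,
    Matrix.cons_val_two, Matrix.head_cons, Matrix.tail_cons] at h1 h2 h3 hc
  refine hpq (sub_eq_zero.1 ?_)
  have e : (c 0 + c 1 + c 2) • (p - q) = 0 := by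
    have hp : (c 0 + c 1 + c 2) • p = p := by rw [hc, one_smul]
    simp only [add_smul] at hp
    have k2 : c 2 • q = c 2 • p := add_left_cancel (h1.trans hp.symm)
    have k1 : c 1 • q = c 1 • p := add_left_cancel (add_right_cancel (h2.trans hp.symm))
    have k0 : c 0 • q = c 0 • p :=
      add_right_cancel (add_right_cancel (h3.trans hp.symm))
    simp only [add_smul, smul_sub, k0, k1, k2, sub_self]
  rwa [hc, one_smul] at e

theorem IsAffineAlgebra.of_surjective {P Q : UAlgebra σ} (h : P.IsAffineAlgebra)
    {φ : P.carrier → Q.carrier} (hφ : IsHom P Q φ) (hs : Function.Surjective φ) :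
    Q.IsAffineAlgebra := by
  obtain ⟨R, _, hR, _, _, hterm, d, hd⟩ := h
  have hdφ : ∀ x y z, φ (x - y + z) = d.eval Q ![φ x, φ y, φ z] := fun x y z => by
    rw [← hd, hφ.eval_three]
  have hsub : ∀ x y, φ (x - y) = φ 0 ↔ φ x = φ y := by
    refine fun x y => ⟨fun hxy => ?_, fun hxy => ?_⟩
    · have e1 := hdφ (x - y) 0 y
      have e2 := hdφ 0 0 y
      rw [hxy, ← e2] at e1
      simpa using e1
    · have e1 := hdφ x y 0
      have e2 := hdφ y y 0
      rw [hxy, ← e2] at e1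
      simpa using e1
  let N : Submodule R P.carrier :=
    { carrier := {x | φ x = φ 0}
      zero_mem' := rfl
      add_mem' := fun {x y} hx hy => by
        have e1 := hdφ x 0 y
        have e2 := hdφ 0 0 0
        simp only [Set.mem_ofPred_eq] at hx hy ⊢
        rw [hx, hy, ← e2] at e1
        simpa using e1
      smul_mem' := fun r x hx => by
        simp only [Set.mem_ofPred_eq] at hx ⊢
        obtain ⟨t, ht⟩ := (hterm 2 fun x => ∑ i, ![r, 1 - r] i • x i).2
          ⟨![r, 1 - r], by simp, fun _ => rfl⟩
        have e1 := hφ.eval_two t x 0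
        have e2 := hφ.eval_two t 0 0
        rw [hx, ← e2, ht, ht] at e1
        simpa using e1 }
  have hmk : ∀ x y, φ x = φ y ↔ N.mkQ x = N.mkQ y := fun x y => by
    rw [← hsub, Submodule.mkQ_apply, Submodule.mkQ_apply, Submodule.Quotient.eq]
    rfl
  let e : Q.carrier ≃ P.carrier ⧸ N := Equiv.ofBijective (fun q => N.mkQ (Function.surjInv hs q))
    ⟨fun p q hpq => by simpa [Function.surjInv_eq hs] using (hmk _ _).2 hpq, fun x => by
      obtain ⟨x, rfl⟩ := N.mkQ_surjective x
      exact ⟨φ x, (hmk _ _).1 (Function.surjInv_eq hs _)⟩⟩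
  have heφ : ∀ x, e (φ x) = N.mkQ x := fun x => (hmk _ _).1 (Function.surjInv_eq hs _)
  let : AddCommGroup Q.carrier := e.addCommGroup
  let : Module R Q.carrier := e.module R
  let L : P.carrier →ₗ[R] Q.carrier := (e.linearEquiv R).symm.toLinearMap ∘ₗ N.mkQ
  have hL : ∀ x, L x = φ x := fun x => e.symm_apply_eq.2 (heφ x).symm
  have key : ∀ {n : ℕ} (t : Term σ n) (c : Fin n → R), (∀ x, t.eval P x = ∑ i, c i • x i) →
      ∀ x, t.eval Q x = ∑ i, c i • x i := by
    intro n t c h x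
    choose y hy using fun i => hs (x i)
    obtain rfl : (fun i => φ (y i)) = x := funext hy
    rw [← hφ.eval, h, ← hL, map_sum]
    simp only [map_smul]
    simp only [hL]
  refine ⟨R, _, hR, inferInstance, inferInstance, fun n g => ⟨?_, ?_⟩, d, fun x y z => ?_⟩
  · rintro ⟨t, ht⟩
    obtain ⟨c, hc, hct⟩ := (hterm n (t.eval P)).1 ⟨t, fun _ => rfl⟩
    exact ⟨c, hc, fun x => (ht x).symm.trans (key t c hct x)⟩
  · rintro ⟨c, hc, hg⟩
    obtain ⟨t, ht⟩ := (hterm n fun x => ∑ i, c i • x i).2 ⟨c, hc, fun _ => rfl⟩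
    exact ⟨t, fun x => (key t c ht x).trans (hg x).symm⟩
  · obtain ⟨x, rfl⟩ := hs x
    obtain ⟨y, rfl⟩ := hs y
    obtain ⟨z, rfl⟩ := hs z
    rw [← hdφ]
    simp only [← hL, map_add, map_sub]

theorem IsAffineAlgebra.of_injective {P Q : UAlgebra σ} (h : Q.IsAffineAlgebra)
    {φ : P.carrier → Q.carrier} (hφ : IsHom P Q φ) (hi : Function.Injective φ)
    (p₀ : P.carrier) : P.IsAffineAlgebra := by
  obtain ⟨R, _, hR, _, _, hterm, d, hd⟩ := h
  have hdφ : ∀ x y z, φ (d.eval P ![x, y, z]) = φ x - φ y + φ z := fun x y z => by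
    rw [hφ.eval_three, hd]
  let N : Submodule R Q.carrier :=
    { carrier := {v | ∃ p, φ p - φ p₀ = v}
      zero_mem' := ⟨p₀, sub_self _⟩
      add_mem' := by
        rintro _ _ ⟨p, rfl⟩ ⟨q, rfl⟩
        refine ⟨d.eval P ![p, p₀, q], ?_⟩
        rw [hdφ]
        abel
      smul_mem' := by
        rintro r _ ⟨p, rfl⟩
        obtain ⟨t, ht⟩ := (hterm 2 fun x => ∑ i, ![r, 1 - r] i • x i).2
          ⟨![r, 1 - r], by simp, fun _ => rfl⟩
        refine ⟨t.eval P ![p, p₀], ?_⟩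
        rw [hφ.eval_two, ht]
        simp only [Fin.sum_univ_two, Matrix.cons_val_zero, Matrix.cons_val_one, sub_smul, one_smul,
          smul_sub]
        abel }
  let e : P.carrier ≃ N := Equiv.ofBijective (fun p => ⟨φ p - φ p₀, p, rfl⟩)
    ⟨fun p q hpq => hi (sub_left_injective (congrArg Subtype.val hpq)), by
      rintro ⟨_, p, rfl⟩
      exact ⟨p, rfl⟩⟩
  let : AddCommGroup P.carrier := e.addCommGroup
  let : Module R P.carrier := e.module R
  let L : P.carrier →ₗ[R] Q.carrier := N.subtype ∘ₗ (e.linearEquiv R).toLinearMap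
  have hL : ∀ p, L p = φ p - φ p₀ := fun _ => rfl
  have hLi : Function.Injective L := fun p q hpq => hi (sub_left_injective hpq)
  have key : ∀ {n : ℕ} (t : Term σ n) (c : Fin n → R), ∑ i, c i = 1 →
      (∀ x, t.eval Q x = ∑ i, c i • x i) → ∀ x, t.eval P x = ∑ i, c i • x i := by
    intro n t c hc h x
    apply hLi
    rw [hL, hφ.eval, h, map_sum]
    simp only [map_smul]
    simp only [hL, smul_sub, Finset.sum_sub_distrib, ← Finset.sum_smul, hc, one_smul]
  refine ⟨R, _, hR, inferInstance, inferInstance, fun n g => ⟨?_, ?_⟩, d, fun x y z => ?_⟩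
  · rintro ⟨t, ht⟩
    obtain ⟨c, hc, hct⟩ := (hterm n (t.eval Q)).1 ⟨t, fun _ => rfl⟩
    exact ⟨c, hc, fun x => (ht x).symm.trans (key t c hc hct x)⟩
  · rintro ⟨c, hc, hg⟩
    obtain ⟨t, ht⟩ := (hterm n fun x => ∑ i, c i • x i).2 ⟨c, hc, fun _ => rfl⟩
    exact ⟨t, fun x => (key t c hc ht x).trans (hg x).symm⟩
  · apply hLi
    rw [map_add, map_sub, hL, hL, hL, hL, hdφ]
    abel

end Affine

end UAlgebra

namespace UAlgebra

variable {σ : Signature}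

section Simple

theorem Congruence.IsMaximal.isSimple_quot {A : UAlgebra σ} {θ : Congruence A}
    (h : θ.IsMaximal) : (A.quot θ).IsSimple := by
  intro ζ
  let η : Congruence A :=
    { rel := fun x y => ζ.rel (A.quotMk θ x) (A.quotMk θ y)
      refl := fun _ => ζ.refl _
      symm := ζ.symm
      trans := ζ.trans
      compat := fun f x y hxy => by
        rw [isHom_quotMk A θ f, isHom_quotMk A θ f]
        exact ζ.compat f _ _ hxy }
  have hle : θ.le η := fun x y hxy => by
    change ζ.rel (A.quotMk θ x) (A.quotMk θ y)
    rw [quotMk_eq_iff.2 hxy]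
    exact ζ.refl _
  by_cases hη : η.IsFull
  · refine Or.inr fun p q => ?_
    obtain ⟨x, rfl⟩ := quotMk_surjective θ p
    obtain ⟨y, rfl⟩ := quotMk_surjective θ q
    exact hη x y
  · refine Or.inl fun p q => ⟨fun hpq => ?_, fun hpq => hpq ▸ ζ.refl p⟩
    obtain ⟨x, rfl⟩ := quotMk_surjective θ p
    obtain ⟨y, rfl⟩ := quotMk_surjective θ q
    exact quotMk_eq_iff.2 (h.2 η hle hη x y hpq)

theorem IsSimple.kerCong_isMaximal {B Q : UAlgebra σ} (hQ : Q.IsSimple)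
    {φ : B.carrier → Q.carrier} (hφ : IsHom B Q φ) (hs : Function.Surjective φ)
    {p q : Q.carrier} (hpq : p ≠ q) : (kerCong hφ).IsMaximal := by
  refine ⟨fun hf => ?_, fun η hle hη => ?_⟩
  · obtain ⟨x, rfl⟩ := hs p
    obtain ⟨y, rfl⟩ := hs q
    exact hpq (hf x y)
  let ζ : Congruence Q :=
    { rel := fun p q => ∃ x y, φ x = p ∧ φ y = q ∧ η.rel x y
      refl := fun p => by
        obtain ⟨x, rfl⟩ := hs p
        exact ⟨x, x, rfl, rfl, η.refl x⟩
      symm := fun ⟨x, y, hx, hy, hxy⟩ => ⟨y, x, hy, hx, η.symm hxy⟩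
      trans := fun ⟨x, y, hx, hy, hxy⟩ ⟨y', z, hy', hz, hyz⟩ =>
        ⟨x, z, hx, hz, η.trans hxy (η.trans (hle _ _ (hy.trans hy'.symm)) hyz)⟩
      compat := fun f p q hpq => by
        choose x y hx hy hxy using hpq
        exact ⟨_, _, (hφ f x).trans (congrArg _ (funext hx)),
          (hφ f y).trans (congrArg _ (funext hy)), η.compat f x y hxy⟩ }
  rcases hQ ζ with h | h
  · exact fun x y hxy => (h _ _).1 ⟨x, y, rfl, rfl, hxy⟩
  · refine absurd (fun x y => ?_) hη
    obtain ⟨x', y', hx, hy, hxy⟩ := h (φ x) (φ y)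
    exact η.trans (hle x x' hx.symm) (η.trans hxy (hle y' y hy))

end Simple

section Coordinates

/-- If the homomorphism `φ` depends only on the values of the homomorphism `π`, then it induces
a homomorphism on the range of `π`. -/
theorem IsHom.exists_factor {B A Q : UAlgebra σ} {π : B.carrier → A.carrier}
    {φ : B.carrier → Q.carrier} (hπ : IsHom B A π) (hφ : IsHom B Q φ)
    (h : ∀ x y, π x = π y → φ x = φ y) :
    ∃ (F : Set A.carrier) (hF : A.IsClosed F) (ψ : (A.subalg F hF).carrier → Q.carrier),
      IsHom (A.subalg F hF) Q ψ ∧ ∀ x, ∃ y, ψ y = φ x := by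
  have hF : A.IsClosed (Set.range π) := by
    intro f w hw
    choose v hv using hw
    exact ⟨_, (hπ f v).trans (congrArg _ (funext hv))⟩
  refine ⟨Set.range π, hF, fun a => φ a.2.choose, fun f w => ?_, fun x => ⟨⟨π x, x, rfl⟩, ?_⟩⟩
  · rw [← hφ f]
    refine h _ _ ?_
    rw [hπ f]
    refine (hF f _ fun j => (w j).2).choose_spec.trans ?_
    exact congrArg _ (funext fun j => (w j).2.choose_spec.symm)
  · exact h _ _ (Exists.choose_spec (⟨x, rfl⟩ : π x ∈ Set.range π))

/-- The congruence of a subalgebra of a product given by agreement on a set of coordinates. -/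
def agreeOn {ι : Type} (A : ι → UAlgebra σ) {S : Set (UAlgebra.pi A).carrier}
    (hS : (UAlgebra.pi A).IsClosed S) (s : Set ι) : Congruence ((UAlgebra.pi A).subalg S hS) where
  rel x y := ∀ i ∈ s, x.1 i = y.1 i
  refl _ _ _ := rfl
  symm h i hi := (h i hi).symm
  trans h h' i hi := (h i hi).trans (h' i hi)
  compat f _ _ h i hi := congrArg ((A i).interp f) (funext fun j => h j i hi)

/-- If the kernel of `φ` is meet prime among the congruences, then `φ` depends on at most one
coordinate. -/
theorem exists_coordinate_of_prime {ι : Type} [Finite ι] {A : ι → UAlgebra σ}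
    {S : Set (UAlgebra.pi A).carrier} {hS : (UAlgebra.pi A).IsClosed S} {β : Type}
    {φ : ((UAlgebra.pi A).subalg S hS).carrier → β}
    (hprime : ∀ η₁ η₂ : Congruence ((UAlgebra.pi A).subalg S hS),
      (∀ x y, η₁.rel x y → η₂.rel x y → φ x = φ y) →
      (∀ x y, η₁.rel x y → φ x = φ y) ∨ ∀ x y, η₂.rel x y → φ x = φ y) :
    (∀ x y, φ x = φ y) ∨ ∃ i, ∀ x y, x.1 i = y.1 i → φ x = φ y := by
  classical
  have key : ∀ s : Finset ι, (∀ x y, (agreeOn A hS s).rel x y → φ x = φ y) →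
      (∀ x y, φ x = φ y) ∨ ∃ i, ∀ x y, x.1 i = y.1 i → φ x = φ y := by
    intro s
    induction s using Finset.induction_on with
    | empty => exact fun h => Or.inl fun x y => h x y fun i hi => absurd hi (by simp)
    | insert i s _ ih =>
      intro h
      rcases hprime (agreeOn A hS {i}) (agreeOn A hS s) fun x y h1 h2 => h x y fun j hj => by
        rcases Finset.mem_insert.1 hj with rfl | hj
        · exact h1 j rfl
        · exact h2 j hj with h' | h'
      · refine Or.inr ⟨i, fun x y hxy => h' x y ?_⟩
        rintro j rfl
        exact hxy
      · exact ih h'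
  have := Fintype.ofFinite ι
  refine key Finset.univ fun x y hxy => congrArg φ (Subtype.ext (funext fun i => hxy i ?_))
  simp

/-- A subalgebra of a homomorphic image is a homomorphic image of a subalgebra. -/
theorem exists_hom_onto_subalg {P D : UAlgebra σ} {S : Set P.carrier} {hS : P.IsClosed S}
    {φ : (P.subalg S hS).carrier → D.carrier} (hφ : IsHom (P.subalg S hS) D φ)
    (hs : Function.Surjective φ) {C : Set D.carrier} (hC : D.IsClosed C) :
    ∃ (S' : Set P.carrier) (hS' : P.IsClosed S')
      (φ' : (P.subalg S' hS').carrier → (D.subalg C hC).carrier),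
      IsHom (P.subalg S' hS') (D.subalg C hC) φ' ∧ Function.Surjective φ' := by
  refine ⟨{x | ∃ h : x ∈ S, φ ⟨x, h⟩ ∈ C}, fun f w hw => ?_, fun x => ⟨φ ⟨x.1, x.2.1⟩, x.2.2⟩,
    fun f w => Subtype.ext (hφ f fun j => ⟨(w j).1, (w j).2.1⟩), fun y => ?_⟩
  · choose h1 h2 using hw
    exact ⟨hS f w h1, (congrArg (· ∈ C) (hφ f fun j => ⟨w j, h1 j⟩)).mpr (hC f _ h2)⟩
  · obtain ⟨x, hx⟩ := hs y.1
    exact ⟨⟨x.1, x.2, (congrArg (· ∈ C) hx).mpr y.2⟩, Subtype.ext hx⟩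

end Coordinates

section Rigid

/-- A nonconstant homomorphism from a subalgebra restricts to a two-generated subalgebra
all of whose proper congruences are contained in the kernel of the restriction. -/
theorem exists_rigid_pair {A Q : UAlgebra σ} [Finite A.carrier] (hA : A.Idempotent)
    {F : Set A.carrier} {hF : A.IsClosed F} {ψ : (A.subalg F hF).carrier → Q.carrier}
    (hψ : IsHom (A.subalg F hF) Q ψ) (hne : ∃ x y, ψ x ≠ ψ y) :
    ∃ (u v : A.carrier) (ψ' : (A.Sg {u, v}).carrier → Q.carrier),
      IsHom (A.Sg {u, v}) Q ψ' ∧ ψ' (A.sgA u v) ≠ ψ' (A.sgB u v) ∧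
      ∀ η : Congruence (A.Sg {u, v}), ¬ η.IsFull → ∀ x y, η.rel x y → ψ' x = ψ' y := by
  let P : Set A.carrier → Prop := fun E => ∃ x y, ψ x ≠ ψ y ∧ E = A.ClosureSet {x.1, y.1}
  obtain ⟨E, hE⟩ := (Set.toFinite {E | P E}).exists_minimal
    (let ⟨x, y, hxy⟩ := hne; ⟨_, x, y, hxy, rfl⟩)
  obtain ⟨⟨x, y, hxy, rfl⟩, hmin⟩ := hE
  have hsub : A.ClosureSet {x.1, y.1} ⊆ F := Closure.mem hF (by
    rintro a (rfl | rfl)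
    exacts [x.2, y.2])
  refine ⟨x.1, y.1, fun z => ψ ⟨z.1, hsub z.2⟩,
    fun f w => hψ f fun j => ⟨(w j).1, hsub (w j).2⟩, hxy, fun η hη z w hzw => ?_⟩
  by_contra hne
  have hle := hmin (y := A.ClosureSet {z.1, w.1}) ⟨_, _, hne, rfl⟩
    (Closure.mem (closureSet_isClosed _ _) (by
      rintro a (rfl | rfl)
      exacts [z.2, w.2]))
  have key : ∀ c : (A.Sg {x.1, y.1}).carrier, c.1 ∈ A.ClosureSet {z.1, w.1} → η.rel z c := by
    intro c hc
    obtain ⟨t, ht⟩ := mem_closure_pair hc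
    obtain rfl : t.eval (A.Sg {x.1, y.1}) ![z, w] = c :=
      Subtype.ext (((isHom_subtype_val _).eval_two t _ _).trans ht)
    refine (η.isClosed_class (hA.subalg _) z).eval t fun i => ?_
    fin_cases i
    · exact η.refl _
    · exact hzw
  exact hη (Congruence.isFull_of_rel hA (η.trans
    (η.symm (key _ (hle (left_mem_closure _ _)))) (key _ (hle (right_mem_closure _ _)))))

theorem Restricted.exists_type {A Q : UAlgebra σ} [Finite A.carrier] (hA : A.Idempotent)
    {T : Set EdgeType} (hT : EdgeType.unary ∉ T) (hres : A.Restricted T)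
    {F : Set A.carrier} {hF : A.IsClosed F} {ψ : (A.subalg F hF).carrier → Q.carrier}
    (hψ : IsHom (A.subalg F hF) Q ψ) (hne : ∃ x y, ψ x ≠ ψ y)
    (hQ : Q.IsAffineAlgebra ∨
      ∃ t : Term σ 3, ∀ p q, IsMajorityOn (fun x y z => t.eval Q ![x, y, z]) {p, q}) :
    ∃ p q : Q.carrier, p ≠ q ∧
      ((EdgeType.semilattice ∈ T ∧
          ∃ t : Term σ 2, IsSemilatticeOn (fun x y => t.eval Q ![x, y]) {p, q}) ∨
        (EdgeType.majority ∈ T ∧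
          ∃ t : Term σ 3, IsMajorityOn (fun x y z => t.eval Q ![x, y, z]) {p, q}) ∨
        (EdgeType.affine ∈ T ∧
          ¬ ∃ t : Term σ 3, IsMajorityOn (fun x y z => t.eval Q ![x, y, z]) {p, q})) := by
  obtain ⟨u, v, χ, hχ, huv, hrigid⟩ := exists_rigid_pair hA hψ hne
  have hfull : ¬ (kerCong hχ).IsFull := fun h => huv (h _ _)
  have hedge : A.IsEdge u v := by
    refine ⟨fun h => huv (congrArg χ (Subtype.ext h)), kerCong hχ, hfull, ?_⟩
    have hl := isHom_quotLift (θ := kerCong hχ) hχ fun _ _ h => h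
    rcases hQ with hQ | ⟨t, ht⟩
    · exact Or.inr (Or.inl (hQ.of_injective hl (quotLift_kerCong_injective hχ) (A.qa u v _)))
    · exact Or.inr (Or.inr (Or.inr ⟨t, hl.isMajorityOn_of_injective
        (quotLift_kerCong_injective hχ) (ht _ _)⟩))
  have hlift : ∀ η : Congruence (A.Sg {u, v}), η.IsMaximal →
      ∃ l, IsHom ((A.Sg {u, v}).quot η) Q l ∧ Function.Injective l ∧
        l (A.qa u v η) = χ (A.sgA u v) ∧ l (A.qb u v η) = χ (A.sgB u v) := by
    intro η hη
    refine ⟨_, isHom_quotLift hχ (hrigid η hη.1), fun p q hpq => ?_, rfl, rfl⟩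
    obtain ⟨x, rfl⟩ := quotMk_surjective _ p
    obtain ⟨y, rfl⟩ := quotMk_surjective _ q
    exact quotMk_eq_iff.2 (hη.2 (kerCong hχ) (hrigid η hη.1) hfull x y hpq)
  refine ⟨χ (A.sgA u v), χ (A.sgB u v), huv, ?_⟩
  obtain ⟨τ, hτ, hty⟩ := hres u v hedge
  cases τ with
  | unary => exact absurd hτ hT
  | semilattice =>
    obtain ⟨-, η, hη, t, ht⟩ := hty
    obtain ⟨l, hl, -, ha, hb⟩ := hlift η hη
    have := hl.isSemilatticeOn ht
    rw [ha, hb] at this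
    exact Or.inl ⟨hτ, t, this⟩
  | majority =>
    obtain ⟨-, η, hη, ⟨t, ht⟩, -⟩ := hty
    obtain ⟨l, hl, -, ha, hb⟩ := hlift η hη
    have := hl.isMajorityOn ht
    rw [ha, hb] at this
    exact Or.inr (Or.inl ⟨hτ, t, this⟩)
  | affine =>
    obtain ⟨-, η, hη, haff⟩ := hty
    obtain ⟨l, hl, hi, ha, hb⟩ := hlift η hη
    refine Or.inr (Or.inr ⟨hτ, fun ⟨t, ht⟩ => ?_⟩)
    rw [← ha, ← hb] at ht
    exact haff.not_isMajorityOn (fun h => huv (by rw [← ha, ← hb, h])) t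
      (hl.isMajorityOn_of_injective hi ht)

end Rigid

end UAlgebra

namespace UAlgebra

variable {σ : Signature}

section Types

variable {ι : Type} [Finite ι] {A : ι → UAlgebra σ} {T : Set EdgeType}
  {S : Set (UAlgebra.pi A).carrier} {hS : (UAlgebra.pi A).IsClosed S} {Q : UAlgebra σ}
  {φ : ((UAlgebra.pi A).subalg S hS).carrier → Q.carrier}

theorem not_hasSetQuot_of_omitsType1 (hfin : ∀ i, Finite (A i).carrier)
    (hid : ∀ i, (A i).Idempotent) (h1 : ∀ i, (A i).OmitsType1)
    (hφ : IsHom ((UAlgebra.pi A).subalg S hS) Q φ) (hs : Function.Surjective φ) :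
    ¬ HasSetQuot Q := by
  intro h
  obtain ⟨i, hi⟩ := (h.of_surjective hφ hs).of_subalg.exists_of_pi hfin hid
  exact (h1 i).not_hasSetQuot (hid i) hi

theorem affine_mem_of_isAffineAlgebra (hfin : ∀ i, Finite (A i).carrier)
    (hid : ∀ i, (A i).Idempotent) (hT : EdgeType.unary ∉ T) (hres : ∀ i, (A i).Restricted T)
    (hφ : IsHom ((UAlgebra.pi A).subalg S hS) Q φ) (hs : Function.Surjective φ)
    {p q : Q.carrier} (hpq : p ≠ q) (hQ : Q.IsAffineAlgebra) : EdgeType.affine ∈ T := by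
  obtain ⟨x, rfl⟩ := hs p
  obtain ⟨y, rfl⟩ := hs q
  let χ : (UAlgebra.pi A).carrier → Q.carrier := Function.extend Subtype.val φ fun _ => φ x
  have hχ : ∀ w (hw : w ∈ S), χ w = φ ⟨w, hw⟩ := fun w hw =>
    Subtype.val_injective.extend_apply φ _ ⟨w, hw⟩
  obtain ⟨E, hES, hE, ⟨u, hu, v, hv, huv⟩, i, hi⟩ := exists_coordinate hfin hid χ hS
    ⟨x.1, x.2, y.1, y.2, by rwa [hχ _ x.2, hχ _ y.2]⟩
  have hφE : IsHom ((UAlgebra.pi A).subalg E hE) Q fun w => φ ⟨w.1, hES w.2⟩ :=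
    fun f w => hφ f fun j => ⟨(w j).1, hES (w j).2⟩
  have hπ : IsHom ((UAlgebra.pi A).subalg E hE) (A i) fun w => w.1 i := fun _ _ => rfl
  obtain ⟨F, hF, ψ, hψ, hψφ⟩ := hπ.exists_factor hφE fun w z hwz => by
    rw [← hχ w.1 (hES w.2), ← hχ z.1 (hES z.2)]
    exact hi _ w.2 _ z.2 hwz
  have := hfin i
  obtain ⟨p, q, hpq, h⟩ := (hres i).exists_type (hid i) hT hψ (by
    obtain ⟨u', hu'⟩ := hψφ ⟨u, hu⟩
    obtain ⟨v', hv'⟩ := hψφ ⟨v, hv⟩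
    refine ⟨u', v', ?_⟩
    rwa [hu', hv', ← hχ, ← hχ]) (Or.inl hQ)
  rcases h with ⟨-, t, ht⟩ | ⟨-, t, ht⟩ | ⟨h, -⟩
  · exact absurd ht (hQ.not_isSemilatticeOn hpq t)
  · exact absurd ht (hQ.not_isMajorityOn hpq t)
  · exact h

theorem Restricted.semilattice_mem {A : UAlgebra σ} (hA : A.Idempotent)
    (hT : EdgeType.unary ∉ T) (hres : A.Restricted T) {u v : A.carrier} (huv : u ≠ v)
    {t : Term σ 2} (h1 : t.eval A ![u, v] = v) (h2 : t.eval A ![v, u] = v) :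
    EdgeType.semilattice ∈ T := by
  have ht : IsSemilatticeOn (fun x y => t.eval A ![x, y]) {u, v} := by
    have hu := hA.eval_two t u
    have hv := hA.eval_two t v
    refine ⟨?_, ?_, ?_⟩
    · rintro x (rfl | rfl) <;> assumption
    · rintro x (rfl | rfl) y (rfl | rfl) <;> simp only [h1, h2]
    · rintro x (rfl | rfl) y (rfl | rfl) z (rfl | rfl) <;> simp only [h1, h2, hu, hv]
  have htθ : ∀ θ : Congruence (A.Sg {u, v}),
      IsSemilatticeOn (fun x y => t.eval ((A.Sg {u, v}).quot θ) ![x, y])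
        {A.qa u v θ, A.qb u v θ} := fun θ =>
    (isHom_quotMk _ θ).isSemilatticeOn ((isHom_subtype_val
      (closureSet_isClosed A {u, v})).isSemilatticeOn_of_injective Subtype.val_injective
        (p := A.sgA u v) (q := A.sgB u v) ht)
  have hinj : ¬ (kerCong (isHom_subtype_val (closureSet_isClosed A {u, v}))).IsFull :=
    fun h => huv (h (A.sgA u v) (A.sgB u v))
  obtain ⟨τ, hτ, hty⟩ := hres u v ⟨huv, _, hinj, Or.inr (Or.inr (Or.inl ⟨t, htθ _⟩))⟩
  cases τ with
  | unary => exact absurd hτ hT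
  | semilattice => exact hτ
  | majority =>
    obtain ⟨-, η, hη, -, hsl⟩ := hty
    exact absurd ⟨t, htθ η⟩ hsl
  | affine =>
    obtain ⟨-, η, hη, haff⟩ := hty
    refine absurd (htθ η) (haff.not_isSemilatticeOn (fun h => hη.1 ?_) t)
    exact Congruence.isFull_of_rel hA (quotMk_eq_iff.1 h)

theorem semilattice_mem_of_isSemilatticeOn (hfin : ∀ i, Finite (A i).carrier)
    (hid : ∀ i, (A i).Idempotent) (hT : EdgeType.unary ∉ T) (hres : ∀ i, (A i).Restricted T)
    (hφ : IsHom ((UAlgebra.pi A).subalg S hS) Q φ) (hs : Function.Surjective φ)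
    {p q : Q.carrier} (hpq : p ≠ q) {f : Term σ 2}
    (hf : IsSemilatticeOn (fun x y => f.eval Q ![x, y]) {p, q}) : EdgeType.semilattice ∈ T := by
  have hB : ((UAlgebra.pi A).subalg S hS).Idempotent := (Idempotent.pi hid).subalg hS
  have : Finite (UAlgebra.pi A).carrier := inferInstanceAs (Finite (∀ i, (A i).carrier))
  have : Finite ((UAlgebra.pi A).subalg S hS).carrier := Subtype.finite
  have key : ∀ p c : Q.carrier, p ≠ c → f.eval Q ![p, c] = c → f.eval Q ![c, p] = c →
      EdgeType.semilattice ∈ T := by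
    intro p c hpc h1 h2
    obtain ⟨x, rfl⟩ := hs p
    obtain ⟨y, rfl⟩ := hs c
    obtain ⟨t, s, hsy, e1, e2⟩ := exists_thin_lift hB hφ x y f h1 h2
    obtain ⟨i, hi⟩ : ∃ i, x.1 i ≠ s.1 i := by
      by_contra! hc
      exact hpc (by rw [← hsy, Subtype.ext (funext hc)])
    have hπ : IsHom ((UAlgebra.pi A).subalg S hS) (A i) fun w => w.1 i := fun _ _ => rfl
    exact (hres i).semilattice_mem (hid i) hT hi
      ((hπ.eval_two t x s).symm.trans (by rw [e1])) ((hπ.eval_two t s x).symm.trans (by rw [e2]))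
  obtain ⟨hidem, hcomm, hassoc⟩ := hf
  have hp : p ∈ ({p, q} : Set Q.carrier) := by simp
  have hq : q ∈ ({p, q} : Set Q.carrier) := by simp
  have h1 := hassoc p hp p hp q hq
  have h2 := hassoc q hq q hq p hp
  have h3 := hassoc p hp q hq q hq
  have h4 := hassoc q hq p hp p hp
  have hpq' := hcomm p hp q hq
  simp only [hidem p hp, hidem q hq] at h1 h2 h3 h4 hpq'
  by_cases hc : p = f.eval Q ![p, q]
  · refine key q p hpq.symm ?_ ?_
    · rw [← hpq', ← hc]
    · rw [← hc]
  · refine key p _ hc h1 ?_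
    rw [hpq', ← h4]

/-- In a smooth algebra, a simple quotient generated by a majority edge has two elements. -/
theorem IsSmooth.eq_or_eq {A : UAlgebra σ} (hsm : A.IsSmooth) {F : Set A.carrier}
    {hF : A.IsClosed F} {ψ : (A.subalg F hF).carrier → Q.carrier}
    (hψ : IsHom (A.subalg F hF) Q ψ) (hs : Function.Surjective ψ) (hQ : Q.IsSimple)
    {p q : Q.carrier} (hpq : p ≠ q) (hgen : ∀ r, ∃ t : Term σ 2, t.eval Q ![p, q] = r)
    {g : Term σ 3} (hg : IsMajorityOn (fun x y z => g.eval Q ![x, y, z]) {p, q})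
    (hsl : ¬ ∃ t : Term σ 2, IsSemilatticeOn (fun x y => t.eval Q ![x, y]) {p, q})
    (r : Q.carrier) : r = p ∨ r = q := by
  obtain ⟨⟨u, hu⟩, rfl⟩ := hs p
  obtain ⟨⟨v, hv⟩, rfl⟩ := hs q
  have hsub : A.ClosureSet {u, v} ⊆ F := Closure.mem hF (by
    rintro a (rfl | rfl)
    exacts [hu, hv])
  let χ : (A.Sg {u, v}).carrier → Q.carrier := fun z => ψ ⟨z.1, hsub z.2⟩
  have hχ : IsHom (A.Sg {u, v}) Q χ := fun f w => hψ f fun j => ⟨(w j).1, hsub (w j).2⟩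
  have hχs : Function.Surjective χ := fun r => by
    obtain ⟨t, rfl⟩ := hgen r
    exact ⟨t.eval _ ![A.sgA u v, A.sgB u v], hχ.eval_two t _ _⟩
  have hl := isHom_quotLift (θ := kerCong hχ) hχ fun _ _ h => h
  have hcl := hsm u v (kerCong hχ) (Or.inr ⟨hQ.kerCong_isMaximal hχ hχs hpq,
    ⟨g, hl.isMajorityOn_of_injective (quotLift_kerCong_injective hχ) hg⟩,
    fun ⟨t, ht⟩ => hsl ⟨t, hl.isSemilatticeOn ht⟩⟩)
  obtain ⟨z, rfl⟩ := hχs r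
  obtain ⟨_, h⟩ := Closure.mem hcl (by
    rintro a (rfl | rfl)
    · exact ⟨left_mem_closure _ _, Or.inl rfl⟩
    · exact ⟨right_mem_closure _ _, Or.inr rfl⟩) z.2
  exact h

theorem majority_mem_of_isMajorityOn (hfin : ∀ i, Finite (A i).carrier)
    (hid : ∀ i, (A i).Idempotent) (hT : EdgeType.unary ∉ T) (hres : ∀ i, (A i).Restricted T)
    (hsm : ∀ i, (A i).IsSmooth) (h1 : ∀ i, (A i).OmitsType1)
    (hφ : IsHom ((UAlgebra.pi A).subalg S hS) Q φ) (hs : Function.Surjective φ)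
    (hQ : Q.IsSimple) {p q : Q.carrier} (hpq : p ≠ q)
    (hgen : ∀ r, ∃ t : Term σ 2, t.eval Q ![p, q] = r) {g : Term σ 3}
    (hg : IsMajorityOn (fun x y z => g.eval Q ![x, y, z]) {p, q})
    (hsl : ¬ ∃ t : Term σ 2, IsSemilatticeOn (fun x y => t.eval Q ![x, y]) {p, q}) :
    EdgeType.majority ∈ T := by
  have : Finite (UAlgebra.pi A).carrier := inferInstanceAs (Finite (∀ i, (A i).carrier))
  have : Finite ((UAlgebra.pi A).subalg S hS).carrier := Subtype.finite
  have : Finite Q.carrier := Finite.of_surjective φ hs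
  have hB : ((UAlgebra.pi A).subalg S hS).Idempotent := (Idempotent.pi hid).subalg hS
  obtain ⟨i, hi⟩ : ∃ i, ∀ x y, x.1 i = y.1 i → φ x = φ y := by
    refine (exists_coordinate_of_prime fun η₁ η₂ => prime_of_majority hQ (hB.of_surjective hφ hs)
      hφ hs (not_hasSetQuot_of_omitsType1 hfin hid h1 hφ hs) hpq (fun r => ?_) hg
        hsl).resolve_left fun hc => ?_
    · obtain ⟨t, rfl⟩ := hgen r
      exact ⟨_, isTermOp₂_of_term t, rfl⟩
    · obtain ⟨x, rfl⟩ := hs p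
      obtain ⟨y, rfl⟩ := hs q
      exact hpq (hc x y)
  have hπ : IsHom ((UAlgebra.pi A).subalg S hS) (A i) fun w => w.1 i := fun _ _ => rfl
  obtain ⟨F, hF, ψ, hψ, hψφ⟩ := hπ.exists_factor hφ hi
  have hψs : Function.Surjective ψ := fun r => by
    obtain ⟨x, rfl⟩ := hs r
    exact hψφ x
  have htwo := (hsm i).eq_or_eq hψ hψs hQ hpq hgen hg hsl
  have hpair : ∀ r s, r ≠ s → ({r, s} : Set Q.carrier) = {p, q} := by
    intro r s hrs
    rcases htwo r with rfl | rfl <;> rcases htwo s with rfl | rfl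
    · exact absurd rfl hrs
    · rfl
    · exact Set.pair_comm _ _
    · exact absurd rfl hrs
  have hmaj : ∀ r s, IsMajorityOn (fun x y z => g.eval Q ![x, y, z]) {r, s} :=
    fun r s x _ y _ => hg x (htwo x) y (htwo y)
  have := hfin i
  obtain ⟨r, s, hrs, h⟩ := (hres i).exists_type (hid i) hT hψ (by
    obtain ⟨x, rfl⟩ := hψs p
    obtain ⟨y, rfl⟩ := hψs q
    exact ⟨x, y, hpq⟩) (Or.inr ⟨g, hmaj⟩)
  rcases h with ⟨-, t, ht⟩ | ⟨h, -⟩ | ⟨-, h⟩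
  · exact absurd ⟨t, hpair r s hrs ▸ ht⟩ hsl
  · exact h
  · exact absurd ⟨g, hmaj r s⟩ h

end Types

end UAlgebra

/-- finite members of the variety generated by a finite class of
similar smooth finite idempotent `T`-restricted algebras omitting type 1 are
`T`-restricted. -/
theorem stmt_0 (σ : Signature) (T : Set EdgeType)
    (hT : T ⊆ {EdgeType.semilattice, EdgeType.majority, EdgeType.affine})
    (K : Set (UAlgebra σ)) (hKfin : K.Finite)
    (hfin : ∀ A ∈ K, Finite A.carrier) (hne : ∀ A ∈ K, Nonempty A.carrier)
    (hid : ∀ A ∈ K, A.Idempotent) (hsm : ∀ A ∈ K, A.IsSmooth)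
    (h1 : ∀ A ∈ K, A.OmitsType1) (hres : ∀ A ∈ K, A.Restricted T)
    (D : UAlgebra σ) (hDfin : Finite D.carrier) (hDne : Nonempty D.carrier)
    (hvar : ∃ (n : ℕ) (A : Fin n → UAlgebra σ), (∀ i, A i ∈ K) ∧
      ∃ (S : Set (UAlgebra.pi A).carrier) (hS : (UAlgebra.pi A).IsClosed S)
        (φ : ((UAlgebra.pi A).subalg S hS).carrier → D.carrier),
        UAlgebra.IsHom ((UAlgebra.pi A).subalg S hS) D φ ∧ Function.Surjective φ) :
    D.Restricted T := by
  obtain ⟨n, A, hA, S, hS, φ, hφ, hφs⟩ := hvar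
  have hfinA := fun i => hfin _ (hA i)
  have hidA := fun i => hid _ (hA i)
  have hresA := fun i => hres _ (hA i)
  have hu : EdgeType.unary ∉ T := fun h => by simpa using hT h
  have hD : D.Idempotent :=
    ((UAlgebra.Idempotent.pi hidA).subalg hS).of_surjective hφ hφs
  rintro a b ⟨hab, θ, hθ, hty⟩
  have hXfin : Finite (D.Sg {a, b}).carrier := Subtype.finite
  obtain ⟨S', hS', φ', hφ', hφs'⟩ :=
    UAlgebra.exists_hom_onto_subalg hφ hφs (D.closureSet_isClosed {a, b})
  have hq : ∀ η : UAlgebra.Congruence (D.Sg {a, b}),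
      UAlgebra.IsHom ((UAlgebra.pi A).subalg S' hS') ((D.Sg {a, b}).quot η)
        ((D.Sg {a, b}).quotMk η ∘ φ') := fun η => (UAlgebra.isHom_quotMk _ η).comp hφ'
  have hqs : ∀ η : UAlgebra.Congruence (D.Sg {a, b}),
      Function.Surjective ((D.Sg {a, b}).quotMk η ∘ φ') := fun η =>
    (UAlgebra.quotMk_surjective η).comp hφs'
  have hne : ∀ η : UAlgebra.Congruence (D.Sg {a, b}), ¬ η.IsFull → D.qa a b η ≠ D.qb a b η :=
    fun η hη h => hη (UAlgebra.Congruence.isFull_of_rel hD (UAlgebra.quotMk_eq_iff.1 h))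
  obtain ⟨η, hθη, hη⟩ := θ.exists_le_isMaximal hθ
  have hl := UAlgebra.isHom_quotLift (UAlgebra.isHom_quotMk _ η)
    fun x y hxy => UAlgebra.quotMk_eq_iff.2 (hθη x y hxy)
  by_cases hsl : ∃ t : Term σ 2,
      IsSemilatticeOn (fun x y => t.eval ((D.Sg {a, b}).quot η) ![x, y]) {D.qa a b η, D.qb a b η}
  · obtain ⟨t, ht⟩ := hsl
    exact ⟨.semilattice, UAlgebra.semilattice_mem_of_isSemilatticeOn hfinA hidA hu hresA (hq η)
      (hqs η) (hne η hη.1) ht, hab, η, hη, t, ht⟩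
  rcases hty with hty | hty | ⟨t, ht⟩ | ⟨t, ht⟩
  · exact absurd (hty.hasSetQuot (hne θ hθ)) (UAlgebra.not_hasSetQuot_of_omitsType1 hfinA hidA
      (fun i => h1 _ (hA i)) (hq θ) (hqs θ))
  · refine ⟨.affine, UAlgebra.affine_mem_of_isAffineAlgebra hfinA hidA hu hresA (hq θ) (hqs θ)
      (hne θ hθ) hty, hab, η, hη, hty.of_surjective hl fun p => ?_⟩
    obtain ⟨x, rfl⟩ := UAlgebra.quotMk_surjective η p
    exact ⟨UAlgebra.quotMk _ θ x, rfl⟩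
  · exact absurd ⟨t, hl.isSemilatticeOn ht⟩ hsl
  · have hmaj := hl.isMajorityOn ht
    refine ⟨.majority, UAlgebra.majority_mem_of_isMajorityOn hfinA hidA hu hresA
      (fun i => hsm _ (hA i)) (fun i => h1 _ (hA i)) (hq η) (hqs η) hη.isSimple_quot
      (hne η hη.1) (fun r => ?_) hmaj hsl, hab, η, hη, ⟨t, hmaj⟩, hsl⟩
    obtain ⟨x, rfl⟩ := UAlgebra.quotMk_surjective η r
    obtain ⟨s, rfl⟩ := UAlgebra.sg_generated x
    exact ⟨s, ((UAlgebra.isHom_quotMk _ η).eval_two s _ _).symm⟩
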